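/- Given a positive integer k divisible by 4 and a constant δ > 2/k, there exists α > 0 such that the following holds for all sufficiently large n: if G = (V₁, …, V_k, E) is a spanning subgraph of the n-blow-up of the cycle C_k with δ̄(G) ≥ δn and α*_b(G) < αn, then G has a transversal C_k-factor. -/

import Mathlib

namespace TCF
open Finset
open scoped Classical

structure Hyp {k n : ℕ} (E : ZMod k → Fin n → Fin n → Prop) (δ α : ℝ) : Prop where
  out : ∀ i a, δ * n ≤ ((univ.filter fun b => E i a b).card : ℝ)
  inn : ∀ i b, δ * n ≤ ((univ.filter fun a => E i a b).card : ℝ)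
  hole : ∀ i (S T : Finset (Fin n)), α * n ≤ (S.card : ℝ) → α * n ≤ (T.card : ℝ) →
    ∃ a ∈ S, ∃ b ∈ T, E i a b

def IsCyc {k n : ℕ} (E : ZMod k → Fin n → Fin n → Prop) (c : ZMod k → Fin n) : Prop :=
  ∀ i, E i (c i) (c (i + 1))

def Near {k n : ℕ} (E : ZMod k → Fin n → Fin n → Prop) (i : ZMod k) (c : ZMod k → Fin n) : Prop :=
  ∀ j, j ≠ i → j + 1 ≠ i → E j (c j) (c (j + 1))

variable {k n : ℕ} {E : ZMod k → Fin n → Fin n → Prop} {δ α : ℝ}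

theorem zmod_one_ne (hk : 4 ≤ k) : (1 : ZMod k) ≠ 0 := by
  have : Fact (1 < k) := ⟨by omega⟩
  exact one_ne_zero

theorem natCast_ne {a b : ℕ} (ha : a < k) (hb : b < k) (h : a ≠ b) : (a : ZMod k) ≠ (b : ZMod k) := by
  intro h'
  rw [ZMod.natCast_eq_natCast_iff'] at h'
  rw [Nat.mod_eq_of_lt ha, Nat.mod_eq_of_lt hb] at h'
  exact h h'

theorem near_update (hk : 4 ≤ k) {i : ZMod k} {c : ZMod k → Fin n} (hc : Near E i c) {x : Fin n}
    (h1 : E (i - 1) (c (i - 1)) x) (h2 : E i x (c (i + 1))) :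
    IsCyc E (Function.update c i x) := by
  have h10 := zmod_one_ne hk
  intro j
  by_cases hj : j = i
  · subst hj
    have : j + 1 ≠ j := by simpa using h10
    rw [Function.update_self, Function.update_of_ne this]
    exact h2
  · by_cases hj' : j + 1 = i
    · have : j = i - 1 := by rw [← hj']; ring
      rw [hj', Function.update_self, Function.update_of_ne hj, this]
      exact h1
    · rw [Function.update_of_ne hj, Function.update_of_ne hj']
      exact hc j hj hj'

theorem near_of_path (hk : 4 ≤ k) (i : ZMod k) (p : ℕ → Fin n)
    (hp : ∀ j, 0 < j → j + 1 < k → E (i + j) (p j) (p (j + 1))) :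
    ∃ c, Near E i c ∧ ∀ j : ℕ, j < k → c (i + j) = p j := by
  have : NeZero k := ⟨by omega⟩
  have key : ∀ j : ℕ, j < k → p ((i + (j : ZMod k) - i).val) = p j := by
    intro j hj
    rw [add_sub_cancel_left, ZMod.val_natCast, Nat.mod_eq_of_lt hj]
  refine ⟨fun j => p ((j - i).val), ?_, fun j hj => key j hj⟩
  intro j hj hj'
  obtain ⟨m, hm, rfl⟩ : ∃ m : ℕ, m < k ∧ j = i + m := by
    refine ⟨(j - i).val, ZMod.val_lt _, ?_⟩
    simp
  have hm0 : 0 < m := by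
    rcases Nat.eq_zero_or_pos m with h | h
    · subst h; simp at hj
    · exact h
  have hm1 : m + 1 < k := by
    by_contra hcon
    have : m + 1 = k := by omega
    apply hj'
    have : ((m + 1 : ℕ) : ZMod k) = 0 := by rw [this]; simp
    push_cast at this
    rw [add_assoc, this, add_zero]
  have e1 := key m hm
  have e2 := key (m+1) hm1
  have : i + (m:ZMod k) + 1 = i + ((m+1 : ℕ) : ZMod k) := by push_cast; ring
  simp only
  rw [this, e1, e2]
  exact hp m hm0 hm1

/-- path lemma -/
theorem path_aux (H : Hyp E δ α) (i0 : ZMod k) (A : ℕ → Finset (Fin n)) (L : ℕ)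
    (h0 : α * n ≤ ((A 0).card : ℝ)) (hA : ∀ j, 0 < j → j ≤ L → 2 * α * n ≤ ((A j).card : ℝ)) :
    α * n ≤ (((A L).filter fun b => ∃ p : ℕ → Fin n, p L = b ∧ (∀ j ≤ L, p j ∈ A j) ∧
      ∀ j < L, E (i0 + j) (p j) (p (j + 1))).card : ℝ) := by
  induction L with
  | zero =>
    convert h0 using 3
    apply Finset.filter_true_of_mem
    intro b hb
    exact ⟨fun _ => b, rfl, by simpa using hb, by simp⟩
  | succ L ih =>
    have ih := ih (fun j h1 h2 => hA j h1 (by omega))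
    set R := ((A L).filter fun b => ∃ p : ℕ → Fin n, p L = b ∧ (∀ j ≤ L, p j ∈ A j) ∧
      ∀ j < L, E (i0 + j) (p j) (p (j + 1))) with hR
    set P : Fin n → Prop := fun b => ∃ p : ℕ → Fin n, p (L+1) = b ∧ (∀ j ≤ L+1, p j ∈ A j) ∧
      ∀ j < L+1, E (i0 + j) (p j) (p (j + 1)) with hP
    by_contra hcon
    have h2 := hA (L+1) (by omega) le_rfl
    have h3 : ((A (L+1)).filter P).card + ((A (L+1)).filter (fun b => ¬ P b)).card = (A (L+1)).card :=
      Finset.card_filter_add_card_filter_not _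
    have h3' : (((A (L+1)).filter P).card : ℝ) + ((A (L+1)).filter (fun b => ¬ P b)).card = (A (L+1)).card := by
      exact_mod_cast h3
    obtain ⟨a, ha, b, hb, hab⟩ := H.hole (i0 + L) R ((A (L+1)).filter (fun b => ¬ P b)) ih (by linarith)
    rw [Finset.mem_filter] at hb
    apply hb.2
    rw [hR, Finset.mem_filter] at ha
    obtain ⟨_, p, hpL, hp1, hp2⟩ := ha
    refine ⟨Function.update p (L+1) b, by simp, ?_, ?_⟩
    · intro j hj
      by_cases h : j = L + 1
      · subst h; simpa using hb.1
      · rw [Function.update_of_ne h]; exact hp1 j (by omega)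
    · intro j hj
      by_cases h : j = L
      · subst h
        rw [Function.update_of_ne (by omega), Function.update_self, hpL]; exact hab
      · rw [Function.update_of_ne (by omega), Function.update_of_ne (by omega)]
        exact hp2 j (by omega)

theorem path (H : Hyp E δ α) (i0 : ZMod k) (A : ℕ → Finset (Fin n)) (L : ℕ) (hL : 0 < L)
    (h0 : α * n ≤ ((A 0).card : ℝ)) (hA : ∀ j, 0 < j → j < L → 2 * α * n ≤ ((A j).card : ℝ))
    (hl : α * n ≤ ((A L).card : ℝ)) :
    ∃ p : ℕ → Fin n, (∀ j ≤ L, p j ∈ A j) ∧ ∀ j < L, E (i0 + j) (p j) (p (j + 1)) := by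
  obtain ⟨L, rfl⟩ : ∃ m, L = m + 1 := ⟨L - 1, by omega⟩
  have := path_aux H i0 A L h0 (fun j h1 h2 => hA j h1 (by omega))
  obtain ⟨a, ha, b, hb, hab⟩ := H.hole (i0 + L) _ _ this hl
  rw [Finset.mem_filter] at ha
  obtain ⟨_, p, hpL, hp1, hp2⟩ := ha
  refine ⟨Function.update p (L+1) b, ?_, ?_⟩
  · intro j hj
    by_cases h : j = L + 1
    · subst h; simpa using hb
    · rw [Function.update_of_ne h]; exact hp1 j (by omega)
  · intro j hj
    by_cases h : j = L
    · subst h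
      rw [Function.update_of_ne (by omega), Function.update_self, hpL]; exact hab
    · rw [Function.update_of_ne (by omega), Function.update_of_ne (by omega)]
      exact hp2 j (by omega)

/-- Near-cycle at `i` whose vertices at `i+1`, ..., `i-1` lie in prescribed sets. -/
theorem near_sets (hk : 4 ≤ k) (H : Hyp E δ α) (i : ZMod k) (A : ZMod k → Finset (Fin n))
    (h1 : α * n ≤ ((A (i+1)).card : ℝ)) (h2 : α * n ≤ ((A (i-1)).card : ℝ))
    (hA : ∀ j, j ≠ i → j ≠ i + 1 → j ≠ i - 1 → 2 * α * n ≤ ((A j).card : ℝ)) :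
    ∃ c, Near E i c ∧ ∀ j, j ≠ i → c j ∈ A j := by
  have : NeZero k := ⟨by omega⟩
  have hcast : ((k - 1 : ℕ) : ZMod k) = -1 := by
    rw [Nat.cast_sub (by omega)]; simp
  obtain ⟨p, hp1, hp2⟩ := path H (i+1) (fun j => A (i + 1 + j)) (k-2) (by omega) (by simpa using h1)
    (by
      intro j hj hj'
      have e : i + 1 + (j : ZMod k) = i + ((j + 1 : ℕ) : ZMod k) := by push_cast; ring
      rw [e]
      apply hA
      · intro h
        have : ((j+1 : ℕ) : ZMod k) = ((0:ℕ) : ZMod k) := by simpa using h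
        exact natCast_ne (by omega) (by omega) (by omega) this
      · intro h
        have : ((j+1 : ℕ) : ZMod k) = ((1:ℕ) : ZMod k) := by simpa using h
        exact natCast_ne (by omega) (by omega) (by omega) this
      · intro h
        have : ((j+1 : ℕ) : ZMod k) = ((k-1:ℕ) : ZMod k) := by
          rw [hcast]; rw [sub_eq_add_neg] at h; exact add_left_cancel h
        exact natCast_ne (by omega) (by omega) (by omega) this)
    (by
      have e : i + 1 + ((k - 2 : ℕ) : ZMod k) = i - 1 := by
        rw [Nat.cast_sub (by omega)]; simp; ring
      rw [e]; exact h2)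
  obtain ⟨c, hc, hcp⟩ := near_of_path (E := E) hk i (fun j => p (j - 1)) (by
    intro j hj hj'
    obtain ⟨m, rfl⟩ : ∃ m, j = m + 1 := ⟨j - 1, by omega⟩
    have := hp2 m (by omega)
    have e : i + ((m + 1 : ℕ) : ZMod k) = i + 1 + m := by push_cast; ring
    rw [e]
    simpa using this)
  refine ⟨c, hc, ?_⟩
  intro j hj
  obtain ⟨m, hm, rfl⟩ : ∃ m : ℕ, m < k ∧ j = i + m := by
    refine ⟨(j - i).val, ZMod.val_lt _, ?_⟩
    simp
  have hm0 : 0 < m := by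
    rcases Nat.eq_zero_or_pos m with h | h
    · subst h; simp at hj
    · exact h
  rw [hcp m hm]
  obtain ⟨m, rfl⟩ : ∃ t, m = t + 1 := ⟨m - 1, by omega⟩
  have := hp1 m (by omega)
  have e : i + ((m + 1 : ℕ) : ZMod k) = i + 1 + m := by push_cast; ring
  rw [e]
  simpa using this

/-- cycle through a vertex -/
theorem cyc_vertex (hk : 4 ≤ k) (H : Hyp E δ α) (i : ZMod k) (v : Fin n)
    (A : ZMod k → Finset (Fin n)) (hA : ∀ j, 2 * α * n ≤ ((A j).card : ℝ))
    (h1 : α * n ≤ (((A (i+1)).filter fun b => E i v b).card : ℝ))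
    (h2 : α * n ≤ (((A (i-1)).filter fun b => E (i-1) b v).card : ℝ)) :
    ∃ c, IsCyc E c ∧ c i = v ∧ ∀ j, j ≠ i → c j ∈ A j := by
  have hne : i + 1 ≠ i - 1 := by
    intro h
    have : ((2:ℕ) : ZMod k) = ((0:ℕ):ZMod k) := by
      push_cast
      linear_combination h
    exact natCast_ne (by omega) (by omega) (by omega) this
  have h10 := zmod_one_ne hk
  obtain ⟨c, hc, hcA⟩ := near_sets hk H i (fun j => if j = i + 1 then (A (i+1)).filter (fun b => E i v b)
    else if j = i - 1 then (A (i-1)).filter (fun b => E (i-1) b v) else A j)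
    (by simpa using h1) (by simpa [hne.symm] using h2) (by
      intro j _ hj hj'
      simpa [hj, hj'] using hA j)
  have e1 := hcA (i+1) (by simpa using h10)
  have e2 := hcA (i-1) (by simpa using h10)
  simp only [if_true, mem_filter] at e1
  rw [if_neg hne.symm, if_pos rfl, mem_filter] at e2
  refine ⟨Function.update c i v, near_update hk hc e2.2 e1.2, by simp, ?_⟩
  intro j hj
  rw [Function.update_of_ne hj]
  have := hcA j hj
  split_ifs at this with h h'
  · subst h; exact (mem_filter.1 this).1
  · subst h'; exact (mem_filter.1 this).1
  · exact this

theorem many_dense (S T : Finset (Fin n)) (R : Fin n → Fin n → Prop) (hα : 0 ≤ α)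
    (h : 2 * α * n * n ≤ ∑ x ∈ S, ((T.filter fun y => R x y).card : ℝ)) (hn : 0 < n) :
    α * n ≤ ((S.filter fun x => α * n ≤ ((T.filter fun y => R x y).card : ℝ)).card : ℝ) := by
  by_contra hcon
  push Not at hcon
  have hn' : (0:ℝ) < n := by exact_mod_cast hn
  have hTn : ∀ x, ((T.filter fun y => R x y).card : ℝ) ≤ n := by
    intro x
    exact_mod_cast (Finset.card_le_univ _).trans (by simp)
  have hS : (S.card : ℝ) ≤ n := by
    exact_mod_cast (Finset.card_le_univ _).trans (by simp)
  rw [← Finset.sum_filter_add_sum_filter_not S (fun x => α * n ≤ ((T.filter fun y => R x y).card : ℝ))] at h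
  have a1 : ∑ x ∈ S.filter (fun x => α * n ≤ ((T.filter fun y => R x y).card : ℝ)), ((T.filter fun y => R x y).card : ℝ)
      ≤ (S.filter fun x => α * n ≤ ((T.filter fun y => R x y).card : ℝ)).card • (n:ℝ) :=
    Finset.sum_le_card_nsmul _ _ _ (fun x _ => hTn x)
  have a2 : ∑ x ∈ S.filter (fun x => ¬ α * n ≤ ((T.filter fun y => R x y).card : ℝ)), ((T.filter fun y => R x y).card : ℝ)
      ≤ (S.filter fun x => ¬ α * n ≤ ((T.filter fun y => R x y).card : ℝ)).card • (α * n) :=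
    Finset.sum_le_card_nsmul _ _ _ (fun x hx => by
      have := (mem_filter.1 hx).2
      linarith)
  have a3 : ((S.filter fun x => ¬ α * n ≤ ((T.filter fun y => R x y).card : ℝ)).card : ℝ) ≤ n := by
    refine le_trans ?_ hS
    exact_mod_cast Finset.card_filter_le _ _
  rw [nsmul_eq_mul] at a1 a2
  have a4 : ((S.filter fun x => ¬ α * n ≤ ((T.filter fun y => R x y).card : ℝ)).card : ℝ) * (α * n) ≤ n * (α * n) :=
    mul_le_mul_of_nonneg_right a3 (by positivity)
  have a5 := mul_lt_mul_of_pos_right hcon hn'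
  nlinarith

/-- cycle from two dense slots -/
theorem cyc_dense (hk : 4 ≤ k) (H : Hyp E δ α) (hα : 0 < α) (hn : 0 < n) (i : ZMod k)
    (A : ZMod k → Finset (Fin n)) (hA : ∀ j, 2 * α * n ≤ ((A j).card : ℝ))
    (h1 : 2 * α * n * n ≤ ∑ x ∈ A i, (((A (i+1)).filter fun y => E i x y).card : ℝ))
    (h2 : 2 * α * n * n ≤ ∑ x ∈ A (i+3), (((A (i+2)).filter fun y => E (i+2) y x).card : ℝ)) :
    ∃ c, IsCyc E c ∧ ∀ j, c j ∈ A j := by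
  have : NeZero k := ⟨by omega⟩
  have m1 := many_dense _ _ _ hα.le h1 hn
  have m2 := many_dense _ _ (fun x y => E (i+2) y x) hα.le h2 hn
  set X := (A i).filter fun x => α * n ≤ (((A (i+1)).filter fun y => E i x y).card : ℝ) with hX
  set Z := (A (i+3)).filter fun x => α * n ≤ (((A (i+2)).filter fun y => E (i+2) y x).card : ℝ) with hZ
  have ek : i + 3 + ((k - 3 : ℕ) : ZMod k) = i := by
    rw [Nat.cast_sub (by omega)]; simp
  obtain ⟨p, hp1, hp2⟩ := path H (i+3) (fun j => if j = 0 then Z else if j = k - 3 then X else A (i + 3 + j))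
    (k-3) (by omega) (by simpa using m2)
    (by
      intro j hj hj'
      simp only [if_neg hj.ne', if_neg hj'.ne]
      exact hA _)
    (by
      have : k - 3 ≠ 0 := by omega
      simpa [this] using m1)
  have hz : p 0 ∈ Z := by simpa using hp1 0 (by omega)
  have hx : p (k-3) ∈ X := by
    have : k - 3 ≠ 0 := by omega
    simpa [this] using hp1 (k-3) le_rfl
  have hpA : ∀ j ≤ k - 3, p j ∈ A (i + 3 + j) := by
    intro j hj
    have := hp1 j hj
    split_ifs at this with h h'
    · subst h; simpa using (mem_filter.1 this).1
    · subst h'; rw [ek]; exact (mem_filter.1 this).1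
    · exact this
  obtain ⟨y, hy, z, hzz, hyz⟩ := H.hole (i+1) _ _ (mem_filter.1 hx).2 (mem_filter.1 hz).2
  rw [mem_filter] at hy hzz
  obtain ⟨c, hc, hcp⟩ := near_of_path (E := E) hk (i+2) (fun j => if j = k - 1 then y else p (j - 1)) (by
    intro j hj hj'
    obtain ⟨m, rfl⟩ : ∃ m, j = m + 1 := ⟨j - 1, by omega⟩
    have e : i + 2 + ((m + 1 : ℕ) : ZMod k) = i + 3 + m := by push_cast; ring
    rw [e, if_neg (by omega)]
    by_cases hm : m + 1 + 1 = k - 1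
    · rw [if_pos hm]
      have hm3 : m = k - 3 := by omega
      subst hm3
      rw [ek]
      simpa using hy.2
    · rw [if_neg hm]
      simpa using hp2 m (by omega))
  have hcm : c (i + 2 - 1) = y := by
    have := hcp (k-1) (by omega)
    rw [if_pos rfl] at this
    rw [← this]
    congr 1
    rw [Nat.cast_sub (by omega)]; simp; ring
  have hcp1 : c (i + 2 + 1) = p 0 := by
    have := hcp 1 (by omega)
    rw [if_neg (by omega)] at this
    simpa using this
  have e21 : i + 2 - 1 = i + 1 := by ring
  refine ⟨Function.update c (i+2) z, near_update hk hc ?_ ?_, ?_⟩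
  · rw [hcm, e21]; exact hyz
  · rw [hcp1]; exact hzz.2
  · intro j
    by_cases hj : j = i + 2
    · subst hj; simpa using hzz.1
    · rw [Function.update_of_ne hj]
      obtain ⟨m, hm, rfl⟩ : ∃ m : ℕ, m < k ∧ j = i + 2 + m := by
        refine ⟨(j - (i + 2)).val, ZMod.val_lt _, ?_⟩
        simp
      have hm0 : 0 < m := by
        rcases Nat.eq_zero_or_pos m with h | h
        · subst h; simp at hj
        · exact h
      rw [hcp m hm]
      by_cases hm1 : m = k - 1
      · rw [if_pos hm1]
        have : i + 2 + (m : ZMod k) = i + 1 := by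
          rw [hm1, Nat.cast_sub (by omega)]; simp; ring
        rw [this]; exact hy.1
      · rw [if_neg hm1]
        obtain ⟨m, rfl⟩ : ∃ t, m = t + 1 := ⟨m - 1, by omega⟩
        have := hpA m (by omega)
        have e : i + 2 + ((m + 1 : ℕ) : ZMod k) = i + 3 + m := by push_cast; ring
        rw [e]
        simpa using this

end TCF

namespace TCF
open Finset
open scoped Classical

variable {k n : ℕ} {E : ZMod k → Fin n → Fin n → Prop} {δ α : ℝ}

theorem card_filter_ge (A : Finset (Fin n)) (P : Fin n → Prop) :
    ((univ.filter P).card : ℝ) - (Aᶜ.card : ℝ) ≤ ((A.filter P).card : ℝ) := by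
  have : univ.filter P ⊆ A.filter P ∪ Aᶜ := by
    intro x hx
    simp only [mem_union, mem_filter, mem_compl, mem_univ, true_and] at hx ⊢
    tauto
  have := (card_le_card this).trans (card_union_le _ _)
  have : ((univ.filter P).card : ℝ) ≤ (A.filter P).card + Aᶜ.card := by exact_mod_cast this
  linarith

theorem card_ge (A : Finset (Fin n)) : (n : ℝ) - (Aᶜ.card : ℝ) = (A.card : ℝ) := by
  have := card_add_card_compl A
  rw [Fintype.card_fin] at this
  have : (A.card : ℝ) + Aᶜ.card = n := by exact_mod_cast this
  linarith

structure Par (k : ℕ) (δ α β : ℝ) : Prop where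
  hk : 4 ≤ k
  hk4 : 4 ∣ k
  hα : 0 < α
  hαβ : α ≤ β
  hβδ : 2 / (k : ℝ) + 8 * β ≤ δ
  hδ : δ ≤ 1

theorem near_conn {β : ℝ} (P : Par k δ α β) (H : Hyp E δ α) (hn : 0 < n) (i : ZMod k) (a a' : Fin n)
    (A : ZMod k → Finset (Fin n)) (hA : ∀ j, ((A j)ᶜ.card : ℝ) ≤ 2 * β * n) :
    ∃ c, Near E i c ∧ c (i+1) = a ∧ c (i-1) = a' ∧
      ∀ j, j ≠ i → j ≠ i + 1 → j ≠ i - 1 → c j ∈ A j := by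
  have hk := P.hk
  have : NeZero k := ⟨by omega⟩
  have hn' : (0:ℝ) < n := by exact_mod_cast hn
  have hα := P.hα
  have hαβ := P.hαβ
  have hβδ := P.hβδ
  have hδ := P.hδ
  have hkp : (0:ℝ) < 2 / (k:ℝ) := by
    have : (0:ℝ) < k := by exact_mod_cast (by omega : 0 < k)
    positivity
  have ek4 : i + 2 + ((k - 4 : ℕ) : ZMod k) = i - 2 := by
    rw [Nat.cast_sub (by omega)]; simp; ring
  have hmain : ∃ p : ℕ → Fin n, E (i+1) a (p 0) ∧ E (i-2) (p (k-4)) a' ∧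
      (∀ j ≤ k - 4, p j ∈ A (i + 2 + j)) ∧ ∀ j < k - 4, E (i + 2 + j) (p j) (p (j+1)) := by
    have c1 := card_filter_ge (A (i+2)) (fun b => E (i+1) a b)
    have c2 := H.out (i+1) a
    have c3 := hA (i+2)
    have c4 := card_filter_ge (A (i-2)) (fun b => E (i-2) b a')
    have c5 := H.inn (i-2) a'
    have c6 := hA (i-2)
    by_cases h4 : k = 4
    · have ei : i - 2 = i + 2 := by
        rw [← ek4]; subst h4; simp
      rw [ei] at c4 c5 c6
      have hne : ((((A (i+2)).filter fun b => E (i+1) a b)) ∩ ((A (i+2)).filter fun b => E (i+2) b a')).Nonempty := by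
        rw [← card_pos]
        have h1 := card_union_add_card_inter ((A (i+2)).filter fun b => E (i+1) a b) ((A (i+2)).filter fun b => E (i+2) b a')
        have h1' : ((((A (i+2)).filter fun b => E (i+1) a b) ∪ ((A (i+2)).filter fun b => E (i+2) b a')).card : ℝ)
          + ((((A (i+2)).filter fun b => E (i+1) a b)) ∩ ((A (i+2)).filter fun b => E (i+2) b a')).card = 
          ((A (i+2)).filter fun b => E (i+1) a b).card + ((A (i+2)).filter fun b => E (i+2) b a').card := by
          exact_mod_cast h1
        have h2 : ((((A (i+2)).filter fun b => E (i+1) a b) ∪ ((A (i+2)).filter fun b => E (i+2) b a')).card : ℝ) ≤ n := by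
          exact_mod_cast (Finset.card_le_univ _).trans (by simp)
        have h3 : (1/2 + 8 * β) * n ≤ δ * n := by
          apply mul_le_mul_of_nonneg_right _ hn'.le
          rw [h4] at hβδ
          norm_num at hβδ ⊢
          linarith
        have h5 : 0 < β * n := by apply mul_pos _ hn'; linarith
        have h4 : (0:ℝ) < ((((A (i+2)).filter fun b => E (i+1) a b)) ∩ ((A (i+2)).filter fun b => E (i+2) b a')).card := by
          nlinarith
        exact_mod_cast h4
      obtain ⟨m, hm⟩ := hne
      simp only [mem_inter, mem_filter] at hm
      refine ⟨fun _ => m, hm.1.2, ?_, ?_, ?_⟩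
      · rw [ei]; exact hm.2.2
      · intro j hj
        have : j = 0 := by omega
        subst this
        simpa using hm.1.1
      · intro j hj; omega
    · have hk5 : 4 < k := by omega
      have hlow : α * n ≤ δ * n - 2 * β * n := by
        have : α * n ≤ (δ - 2 * β) * n := mul_le_mul_of_nonneg_right (by linarith) hn'.le
        linarith
      obtain ⟨p, hp1, hp2⟩ := path H (i+2) (fun j => if j = 0 then (A (i+2)).filter (fun b => E (i+1) a b)
        else if j = k - 4 then (A (i-2)).filter (fun b => E (i-2) b a') else A (i + 2 + j)) (k-4) (by omega)
        (by simp only [if_true]; linarith)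
        (by
          intro j hj hj'
          simp only [if_neg hj.ne', if_neg hj'.ne]
          have := card_ge (A (i+2+j))
          have := hA (i+2+j)
          have : 2 * α * n ≤ (1 - 2 * β) * n := mul_le_mul_of_nonneg_right (by linarith) hn'.le
          linarith)
        (by
          have : k - 4 ≠ 0 := by omega
          simp only [if_neg this, if_true]; linarith)
      refine ⟨p, ?_, ?_, ?_, hp2⟩
      · have := hp1 0 (by omega)
        simp only [if_true] at this
        exact (mem_filter.1 this).2
      · have h := hp1 (k-4) le_rfl
        have : k - 4 ≠ 0 := by omega
        simp only [if_neg this, if_true] at h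
        exact (mem_filter.1 h).2
      · intro j hj
        have := hp1 j hj
        split_ifs at this with h h'
        · subst h; simpa using (mem_filter.1 this).1
        · subst h'; rw [ek4]; exact (mem_filter.1 this).1
        · exact this
  obtain ⟨p, hp0, hpl, hpA, hpE⟩ := hmain
  obtain ⟨c, hc, hcp⟩ := near_of_path (E := E) hk i (fun j => if j = 1 then a else if j = k - 1 then a' else p (j-2)) (by
    intro j hj hj'
    by_cases h1 : j = 1
    · subst h1
      rw [if_pos rfl, if_neg (by omega), if_neg (by omega)]
      simpa using hp0
    · obtain ⟨m, rfl⟩ : ∃ m, j = m + 2 := ⟨j - 2, by omega⟩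
      have e : i + ((m + 2 : ℕ) : ZMod k) = i + 2 + m := by push_cast; ring
      rw [e, if_neg (by omega), if_neg (by omega), if_neg (by omega)]
      by_cases h2 : m + 2 + 1 = k - 1
      · rw [if_pos h2]
        have : m = k - 4 := by omega
        subst this
        rw [ek4]
        simpa using hpl
      · rw [if_neg h2]
        have := hpE m (by omega)
        simpa using this)
  have ekm : i + ((k - 1 : ℕ) : ZMod k) = i - 1 := by
    rw [Nat.cast_sub (by omega)]; simp; ring
  refine ⟨c, hc, ?_, ?_, ?_⟩
  · have := hcp 1 (by omega)
    simpa using this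
  · have := hcp (k-1) (by omega)
    rw [ekm] at this
    rw [this, if_neg (by omega), if_pos rfl]
  · intro j hj hj1 hj2
    obtain ⟨m, hm, rfl⟩ : ∃ m : ℕ, m < k ∧ j = i + m := by
      refine ⟨(j - i).val, ZMod.val_lt _, ?_⟩
      simp
    have hm0 : m ≠ 0 := by rintro rfl; simp at hj
    have hm1 : m ≠ 1 := by rintro rfl; simp at hj1
    have hm2 : m ≠ k - 1 := by rintro rfl; exact hj2 ekm
    rw [hcp m hm, if_neg hm1, if_neg hm2]
    obtain ⟨m, rfl⟩ : ∃ t, m = t + 2 := ⟨m - 2, by omega⟩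
    have e : i + ((m + 2 : ℕ) : ZMod k) = i + 2 + m := by push_cast; ring
    rw [e]
    simpa using hpA m (by omega)

/-! ### Tilings -/

def Til (E : ZMod k → Fin n → Fin n → Prop) (T : Finset (ZMod k → Fin n)) : Prop :=
  (∀ c ∈ T, IsCyc E c) ∧ ∀ c ∈ T, ∀ c' ∈ T, c ≠ c' → ∀ i, c i ≠ c' i

def Tile (E : ZMod k → Fin n → Fin n → Prop) (S : Finset (ZMod k × Fin n)) : Prop :=
  ∃ T : Finset (ZMod k → Fin n), Til E T ∧ ∀ i a, (i, a) ∈ S ↔ ∃ c ∈ T, c i = a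

def slice (S : Finset (ZMod k × Fin n)) (i : ZMod k) : Finset (Fin n) :=
  univ.filter fun a => (i, a) ∈ S

@[simp] theorem mem_slice {S : Finset (ZMod k × Fin n)} {i : ZMod k} {a : Fin n} :
    a ∈ slice S i ↔ (i, a) ∈ S := by simp [slice]

theorem Til.card_image {T : Finset (ZMod k → Fin n)} (hT : Til E T) (i : ZMod k) :
    (T.image fun c => c i).card = T.card := by
  apply Finset.card_image_of_injOn
  intro c hc c' hc' h
  by_contra hne
  exact hT.2 c hc c' hc' hne i h

theorem Tile.card {S : Finset (ZMod k × Fin n)} (h : Tile E S) : ∃ t, ∀ i, (slice S i).card = t := by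
  obtain ⟨T, hT, hS⟩ := h
  refine ⟨T.card, fun i => ?_⟩
  rw [← hT.card_image i]
  congr 1
  ext a
  simp [hS]

theorem Tile.union {S S' : Finset (ZMod k × Fin n)} (h : Tile E S) (h' : Tile E S')
    (hd : Disjoint S S') : Tile E (S ∪ S') := by
  obtain ⟨T, hT, hS⟩ := h
  obtain ⟨T', hT', hS'⟩ := h'
  rw [Finset.disjoint_left] at hd
  refine ⟨T ∪ T', ⟨?_, ?_⟩, ?_⟩
  · intro c hc
    rcases mem_union.1 hc with h | h
    · exact hT.1 c h
    · exact hT'.1 c h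
  · intro c hc c' hc' hne i heq
    rcases mem_union.1 hc with h | h <;> rcases mem_union.1 hc' with h' | h'
    · exact hT.2 c h c' h' hne i heq
    · exact hd ((hS i (c i)).2 ⟨c, h, rfl⟩) ((hS' i (c i)).2 ⟨c', h', heq.symm⟩)
    · exact hd ((hS i (c i)).2 ⟨c', h', heq.symm⟩) ((hS' i (c i)).2 ⟨c, h, rfl⟩)
    · exact hT'.2 c h c' h' hne i heq
  · intro i a
    rw [mem_union, hS, hS']
    constructor
    · rintro (⟨c, hc, h⟩ | ⟨c, hc, h⟩)
      · exact ⟨c, mem_union_left _ hc, h⟩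
      · exact ⟨c, mem_union_right _ hc, h⟩
    · rintro ⟨c, hc, h⟩
      rcases mem_union.1 hc with h' | h'
      · exact Or.inl ⟨c, h', h⟩
      · exact Or.inr ⟨c, h', h⟩

theorem Tile.empty : Tile E (∅ : Finset (ZMod k × Fin n)) :=
  ⟨∅, ⟨by simp, by simp⟩, by simp⟩

theorem Tile.biUnion {ι : Type*} (s : Finset ι) (f : ι → Finset (ZMod k × Fin n))
    (h : ∀ x ∈ s, Tile E (f x)) (hd : ∀ x ∈ s, ∀ y ∈ s, x ≠ y → Disjoint (f x) (f y)) :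
    Tile E (s.biUnion f) := by
  induction s using Finset.induction_on with
  | empty => simpa using Tile.empty
  | insert a s ha ih =>
    rw [Finset.biUnion_insert]
    apply Tile.union (h a (mem_insert_self _ _))
    · exact ih (fun x hx => h x (mem_insert_of_mem hx))
        (fun x hx y hy => hd x (mem_insert_of_mem hx) y (mem_insert_of_mem hy))
    · rw [Finset.disjoint_biUnion_right]
      intro x hx
      apply hd a (mem_insert_self _ _) x (mem_insert_of_mem hx)
      rintro rfl
      exact ha hx

/-- vertex set of the near-cycle, without vertex `i` -/
def pv [NeZero k] (i : ZMod k) (c : ZMod k → Fin n) : Finset (ZMod k × Fin n) :=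
  (univ.erase i).image fun j => (j, c j)

def verts [NeZero k] (c : ZMod k → Fin n) : Finset (ZMod k × Fin n) :=
  univ.image fun j => (j, c j)

theorem mem_pv [NeZero k] {i j : ZMod k} {c : ZMod k → Fin n} {x : Fin n} :
    (j, x) ∈ pv i c ↔ j ≠ i ∧ c j = x := by
  simp only [pv, mem_image, mem_erase, mem_univ, and_true, Prod.mk.injEq]
  constructor
  · rintro ⟨a, h1, rfl, h2⟩; exact ⟨h1, h2⟩
  · rintro ⟨h1, h2⟩; exact ⟨j, h1, rfl, h2⟩

theorem mem_verts [NeZero k] {j : ZMod k} {c : ZMod k → Fin n} {x : Fin n} :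
    (j, x) ∈ verts c ↔ c j = x := by
  simp [verts]

theorem card_pv [NeZero k] (i : ZMod k) (c : ZMod k → Fin n) : (pv i c).card ≤ k := by
  refine card_image_le.trans ((card_le_univ _).trans ?_)
  rw [ZMod.card]

theorem tile_verts [NeZero k] {c : ZMod k → Fin n} (hc : IsCyc E c) : Tile E (verts c) := by
  refine ⟨{c}, ⟨by simpa using hc, by simp⟩, ?_⟩
  intro i a
  simp [mem_verts]

theorem tile_near [NeZero k] (hk : 4 ≤ k) {i : ZMod k} {c : ZMod k → Fin n} (hc : Near E i c) {x : Fin n}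
    (h1 : E (i - 1) (c (i - 1)) x) (h2 : E i x (c (i + 1))) :
    Tile E (insert (i, x) (pv i c)) := by
  have := tile_verts (near_update hk hc h1 h2)
  convert this using 1
  ext ⟨j, y⟩
  rw [mem_insert, mem_pv, mem_verts]
  by_cases hj : j = i
  · subst hj; simp [eq_comm]
  · rw [Function.update_of_ne hj]
    simp [hj]

end TCF

namespace TCF
open Finset
open scoped Classical

variable {k n : ℕ} {E : ZMod k → Fin n → Fin n → Prop} {δ α β : ℝ}

theorem split_disj (X Y : Finset (Fin n)) (hαβ : α ≤ β) (h1 : 1 ≤ β * n) (hα : 0 < α)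
    (hX : 6 * β * n ≤ (X.card : ℝ)) (hY : 6 * β * n ≤ (Y.card : ℝ)) :
    ∃ U ⊆ X, ∃ T ⊆ Y, Disjoint U T ∧ α * n ≤ (U.card : ℝ) ∧ α * n ≤ (T.card : ℝ) := by
  have hab : α * n ≤ β * n := mul_le_mul_of_nonneg_right hαβ (by positivity)
  have hc : (⌈α * n⌉₊ : ℝ) < α * n + 1 := Nat.ceil_lt_add_one (by positivity)
  obtain ⟨U, hU, hUc⟩ := Finset.exists_subset_card_eq (s := X) (n := ⌈α * n⌉₊) (by
    have : (⌈α * n⌉₊ : ℝ) ≤ X.card := by nlinarith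
    exact_mod_cast this)
  refine ⟨U, hU, Y \ U, sdiff_subset, disjoint_sdiff, ?_, ?_⟩
  · rw [hUc]; exact Nat.le_ceil _
  · have := le_card_sdiff U Y
    have : (Y.card : ℝ) ≤ (Y \ U).card + U.card := by
      have : Y.card ≤ (Y \ U).card + U.card := by omega
      exact_mod_cast this
    rw [hUc] at this
    nlinarith

theorem few_bad_out (H : Hyp E δ α) (i : ZMod k) (U : Finset (Fin n)) (hU : α * n ≤ (U.card : ℝ)) :
    ((univ.filter fun w => ¬ ∃ a ∈ U, E i w a).card : ℝ) < α * n := by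
  by_contra h
  push Not at h
  obtain ⟨w, hw, a, ha, h⟩ := H.hole i _ U h hU
  have := (mem_filter.1 hw).2
  grind

theorem few_bad_inn (H : Hyp E δ α) (i : ZMod k) (U : Finset (Fin n)) (hU : α * n ≤ (U.card : ℝ)) :
    ((univ.filter fun w => ¬ ∃ a ∈ U, E i a w).card : ℝ) < α * n := by
  by_contra h
  push Not at h
  obtain ⟨a, ha, w, hw, h⟩ := H.hole i U _ hU h
  have := (mem_filter.1 hw).2
  grind

theorem Par.two_pos (P : Par k δ α β) : 0 < 2 / (k : ℝ) := by
  have : (0:ℝ) < k := by exact_mod_cast (by have := P.hk; omega : 0 < k)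
  positivity

theorem swap (P : Par k δ α β) (H : Hyp E δ α) (hn : 3 ≤ β * n) (F : Finset (ZMod k × Fin n))
    (hF : ∀ j, ((slice F j).card : ℝ) ≤ β * n) (i : ZMod k) (u v : Fin n) :
    ∃ S, Disjoint S F ∧ S.card ≤ 2 * k + 1 ∧ (i, u) ∉ S ∧ (i, v) ∉ S ∧
      Tile E (insert (i, u) S) ∧ Tile E (insert (i, v) S) := by
  have hk := P.hk
  have : NeZero k := ⟨by omega⟩
  have hα := P.hα
  have hαβ := P.hαβ
  have hβδ := P.hβδ
  have hδ := P.hδ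
  have hkp := P.two_pos
  have hn0 : 0 < n := by
    rcases Nat.eq_zero_or_pos n with h | h
    · subst h; norm_num at hn
    · exact h
  have hn' : (0:ℝ) < n := by exact_mod_cast hn0
  have h10 := zmod_one_ne hk
  have hab : α * n ≤ β * n := mul_le_mul_of_nonneg_right hαβ (by positivity)
  have hδn : 8 * β * n ≤ δ * n := mul_le_mul_of_nonneg_right (by linarith) hn'.le
  have hδn1 : δ * n ≤ n := by nlinarith
  set A : ZMod k → Finset (Fin n) := fun j => (slice F j ∪ {u, v})ᶜ with hAdef
  have hA : ∀ j, ((A j)ᶜ.card : ℝ) ≤ β * n + 2 := by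
    intro j
    have : ((A j)ᶜ).card ≤ (slice F j).card + 2 := by
      rw [hAdef]; simp only [compl_compl]
      refine (card_union_le _ _).trans ?_
      have := Finset.card_le_two (a := u) (b := v)
      omega
    have : ((A j)ᶜ.card : ℝ) ≤ (slice F j).card + 2 := by exact_mod_cast this
    linarith [hF j]
  have big : ∀ j (Q : Fin n → Prop), δ * n ≤ ((univ.filter Q).card : ℝ) →
      6 * β * n ≤ (((A j).filter Q).card : ℝ) := by
    intro j Q hQ
    have := card_filter_ge (A j) Q
    have := hA j
    linarith
  obtain ⟨Up, hUp, Tp, hTp, hdp, hUpc, hTpc⟩ := split_disj _ _ hαβ (by linarith) hα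
    (big (i+1) _ (H.out i u)) (big (i+1) _ (H.out i v))
  obtain ⟨Um, hUm, Tm, hTm, hdm, hUmc, hTmc⟩ := split_disj _ _ hαβ (by linarith) hα
    (big (i-1) _ (H.inn (i-1) u)) (big (i-1) _ (H.inn (i-1) v))
  have b1 := few_bad_out H i Up hUpc
  have b2 := few_bad_out H i Tp hTpc
  have b3 := few_bad_inn H (i-1) Um hUmc
  have b4 := few_bad_inn H (i-1) Tm hTmc
  obtain ⟨w, hwA, hw1, hw2, hw3, hw4⟩ : ∃ w ∈ A i, (∃ a ∈ Up, E i w a) ∧ (∃ a ∈ Tp, E i w a) ∧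
      (∃ a ∈ Um, E (i-1) a w) ∧ (∃ a ∈ Tm, E (i-1) a w) := by
    by_contra hcon
    have hsub : A i ⊆ ((univ.filter fun w => ¬ ∃ a ∈ Up, E i w a) ∪ (univ.filter fun w => ¬ ∃ a ∈ Tp, E i w a)) ∪
      ((univ.filter fun w => ¬ ∃ a ∈ Um, E (i-1) a w) ∪ (univ.filter fun w => ¬ ∃ a ∈ Tm, E (i-1) a w)) := by
      intro w hw
      simp only [mem_union, mem_filter, mem_univ, true_and]
      by_contra h
      apply hcon
      exact ⟨w, hw, by tauto⟩
    have h1 := (card_le_card hsub).trans ((card_union_le _ _).trans (add_le_add (card_union_le _ _) (card_union_le _ _)))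
    have h2 : ((A i).card : ℝ) ≤ ((univ.filter fun w => ¬ ∃ a ∈ Up, E i w a).card + (univ.filter fun w => ¬ ∃ a ∈ Tp, E i w a).card) +
      ((univ.filter fun w => ¬ ∃ a ∈ Um, E (i-1) a w).card + (univ.filter fun w => ¬ ∃ a ∈ Tm, E (i-1) a w).card) := by
      exact_mod_cast h1
    have h3 := card_ge (A i)
    have h4 := hA i
    linarith
  obtain ⟨a, haU, hwa⟩ := hw1
  obtain ⟨b, hbT, hwb⟩ := hw2
  obtain ⟨a', haU', hwa'⟩ := hw3
  obtain ⟨b', hbT', hwb'⟩ := hw4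
  obtain ⟨c1, hc1, e1, e1', hcA1⟩ := near_conn P H hn0 i a a' A (fun j => by linarith [hA j])
  obtain ⟨c2, hc2, e2, e2', hcA2⟩ := near_conn P H hn0 i b b' (fun j => A j \ {c1 j}) (fun j => by
    have : (A j \ {c1 j})ᶜ ⊆ (A j)ᶜ ∪ {c1 j} := by
      intro x; simp only [mem_compl, mem_sdiff, mem_union, mem_singleton]; tauto
    have := (card_le_card this).trans (card_union_le _ _)
    have : (((A j \ {c1 j})ᶜ).card : ℝ) ≤ (A j)ᶜ.card + 1 := by
      rw [card_singleton] at this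
      exact_mod_cast this
    linarith [hA j])
  have fa := mem_filter.1 (hUp haU)
  have fb := mem_filter.1 (hTp hbT)
  have fa' := mem_filter.1 (hUm haU')
  have fb' := mem_filter.1 (hTm hbT')
  have hAm1 : ∀ j, j ≠ i → c1 j ∈ A j := by
    intro j hj
    by_cases h : j = i + 1
    · subst h; rw [e1]; exact fa.1
    by_cases h' : j = i - 1
    · subst h'; rw [e1']; exact fa'.1
    exact hcA1 j hj h h'
  have hAm2 : ∀ j, j ≠ i → c2 j ∈ A j ∧ c2 j ≠ c1 j := by
    intro j hj
    by_cases h : j = i + 1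
    · subst h; rw [e1, e2]
      exact ⟨fb.1, fun h => (Finset.disjoint_left.1 hdp haU) (h ▸ hbT)⟩
    by_cases h' : j = i - 1
    · subst h'; rw [e1', e2']
      exact ⟨fb'.1, fun h => (Finset.disjoint_left.1 hdm haU') (h ▸ hbT')⟩
    have := hcA2 j hj h h'
    simpa using this
  have hAiff : ∀ j x, x ∈ A j ↔ (j, x) ∉ F ∧ x ≠ u ∧ x ≠ v := by
    intro j x; simp [hAdef]; tauto
  have hw := (hAiff i w).1 hwA
  have T1u := tile_near hk hc1 (x := u) (by rw [e1']; exact fa'.2) (by rw [e1]; exact fa.2)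
  have T1w := tile_near hk hc1 (x := w) (by rw [e1']; exact hwa') (by rw [e1]; exact hwa)
  have T2v := tile_near hk hc2 (x := v) (by rw [e2']; exact fb'.2) (by rw [e2]; exact fb.2)
  have T2w := tile_near hk hc2 (x := w) (by rw [e2']; exact hwb') (by rw [e2]; exact hwb)
  refine ⟨insert (i, w) (pv i c1 ∪ pv i c2), ?_, ?_, ?_, ?_, ?_, ?_⟩
  · rw [Finset.disjoint_left]
    rintro ⟨j, x⟩ hx hxF
    simp only [mem_insert, mem_union, mem_pv, Prod.mk.injEq] at hx
    rcases hx with ⟨rfl, rfl⟩ | ⟨h1, rfl⟩ | ⟨h1, rfl⟩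
    · exact hw.1 hxF
    · exact ((hAiff _ _).1 (hAm1 j h1)).1 hxF
    · exact ((hAiff _ _).1 (hAm2 j h1).1).1 hxF
  · have := card_pv i c1
    have := card_pv i c2
    have := card_union_le (pv i c1) (pv i c2)
    have := card_insert_le (i, w) (pv i c1 ∪ pv i c2)
    omega
  · simp [mem_pv, hw.2.1.symm]
  · simp [mem_pv, hw.2.2.symm]
  · have : insert (i, u) (insert (i, w) (pv i c1 ∪ pv i c2)) = insert (i, u) (pv i c1) ∪ insert (i, w) (pv i c2) := by
      ext x; simp only [mem_insert, mem_union]; tauto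
    rw [this]
    apply T1u.union T2w
    rw [Finset.disjoint_left]
    rintro ⟨j, x⟩ hx hx'
    simp only [mem_insert, mem_pv, Prod.mk.injEq] at hx hx'
    rcases hx with ⟨h1, h2⟩ | ⟨h1, h2⟩ <;> rcases hx' with ⟨h3, h4⟩ | ⟨h3, h4⟩
    · exact hw.2.1 (h4.symm.trans h2)
    · exact h3 h1
    · exact h1 h3
    · exact (hAm2 j h1).2 (h4.trans h2.symm)
  · have : insert (i, v) (insert (i, w) (pv i c1 ∪ pv i c2)) = insert (i, w) (pv i c1) ∪ insert (i, v) (pv i c2) := by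
      ext x; simp only [mem_insert, mem_union]; tauto
    rw [this]
    apply T1w.union T2v
    rw [Finset.disjoint_left]
    rintro ⟨j, x⟩ hx hx'
    simp only [mem_insert, mem_pv, Prod.mk.injEq] at hx hx'
    rcases hx with ⟨h1, h2⟩ | ⟨h1, h2⟩ <;> rcases hx' with ⟨h3, h4⟩ | ⟨h3, h4⟩
    · exact hw.2.2 (h2.symm.trans h4)
    · exact h3 h1
    · exact h1 h3
    · exact (hAm2 j h1).2 (h4.trans h2.symm)

def Acc (E : ZMod k → Fin n → Fin n → Prop) (i : ZMod k) (A : Finset (ZMod k × Fin n))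
    (Q : Finset (Fin n)) : Prop :=
  ∀ x ∈ Q, (i, x) ∉ A → Tile E (insert (i, x) A)

theorem acc_merge {i : ZMod k} {A1 A2 S : Finset (ZMod k × Fin n)} {Q1 Q2 : Finset (Fin n)} {c1 c2 : Fin n}
    (h1 : Acc E i A1 Q1) (h2 : Acc E i A2 Q2) (hc1 : c1 ∈ Q1) (hc2 : c2 ∈ Q2) (hne : c1 ≠ c2)
    (hd : Disjoint A1 A2) (hS1 : Disjoint S A1) (hS2 : Disjoint S A2)
    (n11 : (i, c1) ∉ A1) (n12 : (i, c1) ∉ A2) (n21 : (i, c2) ∉ A1) (n22 : (i, c2) ∉ A2)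
    (ns1 : (i, c1) ∉ S) (ns2 : (i, c2) ∉ S)
    (t1 : Tile E (insert (i, c1) S)) (t2 : Tile E (insert (i, c2) S)) :
    Acc E i (A1 ∪ A2 ∪ insert (i, c1) (insert (i, c2) S)) (Q1 ∪ Q2) := by
  intro x hx hxA
  simp only [mem_union, mem_insert, not_or, Prod.mk.injEq, true_and] at hxA
  obtain ⟨⟨xA1, xA2⟩, xc1, xc2, xS⟩ := hxA
  rw [Finset.disjoint_left] at hd hS1 hS2
  rcases mem_union.1 hx with hx | hx
  · have a := h1 x hx xA1
    have b := h2 c2 hc2 n22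
    have : insert (i, x) (A1 ∪ A2 ∪ insert (i, c1) (insert (i, c2) S)) =
      (insert (i, x) A1 ∪ insert (i, c2) A2) ∪ insert (i, c1) S := by
      ext y; simp only [mem_insert, mem_union]; tauto
    rw [this]
    apply (a.union b _).union t1
    · rw [Finset.disjoint_left]
      intro y; simp only [mem_insert, mem_union]; grind
    · rw [Finset.disjoint_left]
      intro y; simp only [mem_insert]; grind
  · have a := h2 x hx xA2
    have b := h1 c1 hc1 n11
    have : insert (i, x) (A1 ∪ A2 ∪ insert (i, c1) (insert (i, c2) S)) =
      (insert (i, x) A2 ∪ insert (i, c1) A1) ∪ insert (i, c2) S := by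
      ext y; simp only [mem_insert, mem_union]; tauto
    rw [this]
    apply (a.union b _).union t2
    · rw [Finset.disjoint_left]
      intro y; simp only [mem_insert, mem_union]; grind
    · rw [Finset.disjoint_left]
      intro y; simp only [mem_insert]; grind

/-- averaging: a pair with many common neighbours in `U` -/
theorem core_pair (P : Par k δ α β) (H : Hyp E δ α) (hn : 0 < n) (F : Finset (ZMod k × Fin n))
    (hF : ∀ j, ((slice F j).card : ℝ) ≤ 2 * β * n) (i : ZMod k) (U : Finset (Fin n)) (hU : U.Nonempty) :
    ∃ a b, (i + 1, a) ∉ F ∧ (i - 1, b) ∉ F ∧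
      δ ^ 2 / 4 * U.card ≤ ((U.filter fun x => E i x a ∧ E (i-1) b x).card : ℝ) := by
  by_contra hcon
  push Not at hcon
  have hα := P.hα
  have hαβ := P.hαβ
  have hβδ := P.hβδ
  have hkp := P.two_pos
  have hn' : (0:ℝ) < n := by exact_mod_cast hn
  have hU' : (0:ℝ) < U.card := by exact_mod_cast hU.card_pos
  set A := (slice F (i+1))ᶜ
  set B := (slice F (i-1))ᶜ
  have hup : ∑ p ∈ A ×ˢ B, ((U.filter fun x => E i x p.1 ∧ E (i-1) p.2 x).card : ℝ) ≤ 
      (A ×ˢ B).card • (δ ^ 2 / 4 * U.card) := by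
    apply Finset.sum_le_card_nsmul
    rintro ⟨a, b⟩ hp
    simp only [A, B, mem_product, mem_compl, mem_slice] at hp
    exact (hcon a b hp.1 hp.2).le
  have hAB : (((A ×ˢ B).card : ℕ) : ℝ) ≤ n * n := by
    rw [card_product]
    have h1 : A.card ≤ n := (card_le_univ _).trans (by simp)
    have h2 : B.card ≤ n := (card_le_univ _).trans (by simp)
    exact_mod_cast Nat.mul_le_mul h1 h2
  have heq : ∑ p ∈ A ×ˢ B, (U.filter fun x => E i x p.1 ∧ E (i-1) p.2 x).card =
      ∑ x ∈ U, ((A ×ˢ B).filter fun p => E i x p.1 ∧ E (i-1) p.2 x).card := by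
    simp only [card_filter]
    exact Finset.sum_comm
  have hlow : U.card • ((3/4 * δ * n) * (3/4 * δ * n)) ≤
     ∑ x ∈ U, (((A ×ˢ B).filter fun p => E i x p.1 ∧ E (i-1) p.2 x).card : ℝ) := by
    apply Finset.card_nsmul_le_sum
    intro x hx
    rw [Finset.filter_product (fun a => E i x a) (fun b => E (i-1) b x), card_product]
    have c1 := card_filter_ge A (fun a => E i x a)
    have c2 := card_filter_ge B (fun b => E (i-1) b x)
    have d1 := H.out i x
    have d2 := H.inn (i-1) x
    have f1 := hF (i+1)
    have f2 := hF (i-1)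
    have hAc : Aᶜ.card = (slice F (i+1)).card := by simp [A]
    have hBc : Bᶜ.card = (slice F (i-1)).card := by simp [B]
    rw [hAc] at c1
    rw [hBc] at c2
    have g : 8 * β * n ≤ δ * n := mul_le_mul_of_nonneg_right (by linarith) hn'.le
    push_cast
    have hδ0 : 0 ≤ δ := by linarith
    apply mul_le_mul (by linarith) (by linarith) (by positivity) (by positivity)
  have heq' : ∑ p ∈ A ×ˢ B, ((U.filter fun x => E i x p.1 ∧ E (i-1) p.2 x).card : ℝ) =
      ∑ x ∈ U, (((A ×ˢ B).filter fun p => E i x p.1 ∧ E (i-1) p.2 x).card : ℝ) := by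
    exact_mod_cast heq
  rw [heq'] at hup
  rw [nsmul_eq_mul] at hup hlow
  have hδ0 : 0 < δ := by linarith
  have h5 : ((A ×ˢ B).card : ℝ) * (δ ^ 2 / 4 * U.card) ≤ n * n * (δ ^ 2 / 4 * U.card) :=
    mul_le_mul_of_nonneg_right hAB (by positivity)
  have h6 : 0 < (δ * n)^2 * U.card := by positivity
  nlinarith

end TCF

namespace TCF
open Finset
open scoped Classical

variable {k n : ℕ} {E : ZMod k → Fin n → Fin n → Prop} {δ α β : ℝ}

theorem card_slice_le (A : Finset (ZMod k × Fin n)) (j : ZMod k) : (slice A j).card ≤ A.card := by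
  apply Finset.card_le_card_of_injOn (fun x => (j, x))
  · intro x hx
    simpa using hx
  · intro x _ y _ h
    simpa using h

theorem slice_union (A B : Finset (ZMod k × Fin n)) (j : ZMod k) :
    slice (A ∪ B) j = slice A j ∪ slice B j := by
  ext x; simp

theorem card_slice_union_le (A B : Finset (ZMod k × Fin n)) (j : ZMod k) :
    (slice (A ∪ B) j).card ≤ (slice A j).card + (slice B j).card := by
  rw [slice_union]; exact card_union_le _ _

theorem piece (P : Par k δ α β) (H : Hyp E δ α) (hn : 0 < n) (F : Finset (ZMod k × Fin n))
    (hF : ∀ j, ((slice F j).card : ℝ) ≤ 2 * β * n) (i : ZMod k) (U : Finset (Fin n)) (hU : U.Nonempty) :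
    ∃ (A : Finset (ZMod k × Fin n)) (Q : Finset (Fin n)), Disjoint A F ∧ A.card ≤ k ∧ (∀ x, (i, x) ∉ A) ∧
      Acc E i A Q ∧ Q ⊆ U ∧ δ ^ 2 / 4 * U.card ≤ (Q.card : ℝ) := by
  have : NeZero k := ⟨by have := P.hk; omega⟩
  obtain ⟨a, b, ha, hb, hab⟩ := core_pair P H hn F hF i U hU
  obtain ⟨c, hc, e1, e2, hcA⟩ := near_conn P H hn i a b (fun j => (slice F j)ᶜ) (by simpa using hF)
  refine ⟨pv i c, U.filter fun x => E i x a ∧ E (i-1) b x, ?_, card_pv i c, ?_, ?_, filter_subset _ _, hab⟩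
  · rw [Finset.disjoint_left]
    rintro ⟨j, x⟩ hx hxF
    rw [mem_pv] at hx
    obtain ⟨hj, rfl⟩ := hx
    by_cases h1 : j = i + 1
    · subst h1; rw [e1] at hxF; exact ha hxF
    by_cases h2 : j = i - 1
    · subst h2; rw [e2] at hxF; exact hb hxF
    have := hcA j hj h1 h2
    simp only [mem_compl, mem_slice] at this
    exact this hxF
  · intro x hx
    rw [mem_pv] at hx
    exact hx.1 rfl
  · intro x hx _
    have := (mem_filter.1 hx).2
    exact tile_near P.hk hc (by rw [e2]; exact this.2) (by rw [e1]; exact this.1)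

theorem exists_not_slice (A : Finset (ZMod k × Fin n)) (i : ZMod k) (Q : Finset (Fin n))
    (h : A.card < Q.card) : ∃ x ∈ Q, (i, x) ∉ A := by
  by_contra hcon
  push Not at hcon
  have : Q ⊆ slice A i := fun x hx => by simpa using hcon x hx
  have := card_le_card this
  have := card_slice_le A i
  omega

theorem gadget (P : Par k δ α β) (H : Hyp E δ α) (hn : 3 ≤ β * n) (F : Finset (ZMod k × Fin n))
    (i : ZMod k) (ε : ℝ) (hε : 0 < ε) (hε1 : ε + β ≤ 1) (B : ℕ)
    (hF : ∀ j, ((slice F j).card : ℝ) + 4 * k * (B + 1) ≤ β * n)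
    (hbig : 4 * k * (B + 1) < δ ^ 2 / 4 * (ε * n)) :
    ∃ (A : Finset (ZMod k × Fin n)) (Q : Finset (Fin n)), Disjoint A F ∧ A.card ≤ 4 * k * (B + 1) ∧
      Acc E i A Q ∧ (∀ x ∈ Q, (i, x) ∉ F) ∧ δ ^ 2 / 4 * (ε * n) ≤ (Q.card : ℝ) ∧
      (((univ.filter fun x => (i, x) ∉ F ∧ x ∉ Q).card : ℝ) ≤ ε * n ∨
       ((univ.filter fun x => (i, x) ∉ F ∧ x ∉ Q).card : ℝ) ≤ (1 - δ ^ 2 / 4) ^ (B + 1) * n) := by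
  have hk := P.hk
  have hα := P.hα
  have hαβ := P.hαβ
  have hβδ := P.hβδ
  have hδ := P.hδ
  have hkp := P.two_pos
  have hn0 : 0 < n := by
    rcases Nat.eq_zero_or_pos n with h | h
    · subst h; norm_num at hn
    · exact h
  have hn' : (0:ℝ) < n := by exact_mod_cast hn0
  have hδ0 : 0 < δ := by linarith
  have hγ : 0 < δ ^ 2 / 4 := by positivity
  have hγ1 : 0 ≤ 1 - δ ^ 2 / 4 := by nlinarith
  have hcomp : ∀ (Q U : Finset (Fin n)), Q ⊆ U → δ ^ 2 / 4 * U.card ≤ (Q.card : ℝ) →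
      ((U \ Q).card : ℝ) ≤ (1 - δ ^ 2 / 4) * U.card := by
    intro Q U hQU h
    rw [cast_card_sdiff hQU]
    linarith
  induction B with
  | zero =>
    set U := (slice F i)ᶜ with hUd
    have hUc : ε * n ≤ (U.card : ℝ) := by
      rw [← card_ge]
      have := hF i
      have e : Uᶜ = slice F i := by simp [hUd]
      rw [e]
      have : (ε + β) * n ≤ 1 * n := mul_le_mul_of_nonneg_right hε1 hn'.le
      have : (0:ℝ) ≤ 4 * k * ((0:ℕ) + 1) := by positivity
      linarith
    have hUn : U.Nonempty := by
      rw [← card_pos]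
      have : (0:ℝ) < U.card := lt_of_lt_of_le (by positivity) hUc
      exact_mod_cast this
    obtain ⟨A, Q, h1, h2, h3, h4, h5, h6⟩ := piece P H hn0 F (fun j => by
      have := hF j
      have : (0:ℝ) ≤ 4 * k * ((0:ℕ) + 1) := by positivity
      linarith) i U hUn
    refine ⟨A, Q, h1, by omega, h4, ?_, ?_, Or.inr ?_⟩
    · intro x hx
      have := h5 hx
      simpa [hUd] using this
    · refine le_trans ?_ h6
      exact mul_le_mul_of_nonneg_left hUc hγ.le
    · have : (univ.filter fun x => (i, x) ∉ F ∧ x ∉ Q) = U \ Q := by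
        ext x; simp [hUd]
      rw [this]
      refine (hcomp Q U h5 h6).trans ?_
      simp only [zero_add, pow_one]
      apply mul_le_mul_of_nonneg_left _ hγ1
      exact_mod_cast (card_le_univ _).trans (by simp)
  | succ B ih =>
    push_cast at hF hbig
    have hk0 : (0:ℝ) ≤ k := by positivity
    have hk4 : (4:ℝ) ≤ k := by exact_mod_cast hk
    obtain ⟨A1, Q1, a1, a2, a3, a4, a5, a6⟩ := ih (fun j => by have := hF j; linarith) (by linarith)
    set U := univ.filter fun x => (i, x) ∉ F ∧ x ∉ Q1 with hU
    have a2' : (A1.card : ℝ) ≤ 4 * k * (B + 1) := by exact_mod_cast a2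
    by_cases hsmall : (U.card : ℝ) ≤ ε * n
    · refine ⟨A1, Q1, a1, a2.trans (by gcongr; omega), a3, a4, a5, Or.inl hsmall⟩
    · have hU2 : (U.card : ℝ) ≤ (1 - δ ^ 2 / 4) ^ (B + 1) * n := by tauto
      push Not at hsmall
      have hUn : U.Nonempty := by
        rw [← card_pos]
        have : (0:ℝ) < U.card := lt_of_lt_of_le (by positivity) hsmall.le
        exact_mod_cast this
      have hs1 : ∀ j, ((slice (F ∪ A1) j).card : ℝ) ≤ (slice F j).card + 4 * k * (B + 1) := by
        intro j
        have h1 := card_slice_union_le F A1 j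
        have h2 := card_slice_le A1 j
        have : ((slice (F ∪ A1) j).card : ℝ) ≤ (slice F j).card + A1.card := by
          exact_mod_cast h1.trans (by omega)
        linarith
      obtain ⟨A2, Q2, b1, b2, b3, b4, b5, b6⟩ := piece P H hn0 (F ∪ A1) (fun j => by
        have := hF j
        have := hs1 j
        linarith) i U hUn
      rw [disjoint_union_right] at b1
      have hQ2 : δ ^ 2 / 4 * (ε * n) ≤ (Q2.card : ℝ) := by
        refine le_trans ?_ b6
        exact mul_le_mul_of_nonneg_left hsmall.le hγ.le
      obtain ⟨c1, hc1, hc1A⟩ := exists_not_slice A1 i Q1 (by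
        have : (A1.card : ℝ) < Q1.card := by linarith
        exact_mod_cast this)
      obtain ⟨c2, hc2, hc2A⟩ := exists_not_slice A1 i Q2 (by
        have : (A1.card : ℝ) < Q2.card := by linarith
        exact_mod_cast this)
      have hU2' := b5 hc2
      simp only [hU, mem_filter, mem_univ, true_and] at hU2'
      have hne : c1 ≠ c2 := by rintro rfl; exact hU2'.2 hc1
      obtain ⟨S, s1, s2, s3, s4, s5, s6⟩ := swap P H hn ((F ∪ A1) ∪ A2) (fun j => by
        have h1 := hF j
        have h2 := hs1 j
        have h3 := card_slice_union_le (F ∪ A1) A2 j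
        have h4 := card_slice_le A2 j
        have : ((slice ((F ∪ A1) ∪ A2) j).card : ℝ) ≤ (slice (F ∪ A1) j).card + k := by
          exact_mod_cast h3.trans (by omega)
        linarith) i c1 c2
      simp only [disjoint_union_right] at s1
      refine ⟨A1 ∪ A2 ∪ insert (i, c1) (insert (i, c2) S), Q1 ∪ Q2, ?_, ?_, ?_, ?_, ?_, ?_⟩
      · simp only [disjoint_union_left, disjoint_insert_left]
        exact ⟨⟨a1, b1.1⟩, a4 c1 hc1, hU2'.1, s1.1.1⟩
      · have h1 := card_union_le (A1 ∪ A2) (insert (i, c1) (insert (i, c2) S))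
        have h2 := card_union_le A1 A2
        have h3 := card_insert_le (i, c1) (insert (i, c2) S)
        have h4 := card_insert_le (i, c2) S
        have : 4 * k * (B + 1 + 1) = 4 * k * (B + 1) + 4 * k := by ring
        omega
      · exact acc_merge a3 b4 hc1 hc2 hne b1.2.symm s1.1.2 s1.2 hc1A (b3 _) hc2A (b3 _) s3 s4 s5 s6
      · intro x hx
        rcases mem_union.1 hx with h | h
        · exact a4 x h
        · have := b5 h
          simp only [hU, mem_filter, mem_univ, true_and] at this
          exact this.1
      · refine a5.trans ?_
        exact_mod_cast card_le_card subset_union_left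
      · right
        have : (univ.filter fun x => (i, x) ∉ F ∧ x ∉ Q1 ∪ Q2) = U \ Q2 := by
          ext x; simp [hU]; tauto
        rw [this]
        refine (hcomp Q2 U b5 b6).trans ?_
        rw [pow_succ' _ (B+1), mul_assoc]
        exact mul_le_mul_of_nonneg_left hU2 hγ1

end TCF

namespace TCF
open Finset
open scoped Classical

variable {k n : ℕ} {E : ZMod k → Fin n → Fin n → Prop} {δ α β : ℝ}

theorem card_slice_insert {i j : ZMod k} {x : Fin n} {A : Finset (ZMod k × Fin n)} (h : (i, x) ∉ A) :
    (slice (insert (i, x) A) j).card = (slice A j).card + if j = i then 1 else 0 := by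
  by_cases hj : j = i
  · subst hj
    have : slice (insert (j, x) A) j = insert x (slice A j) := by
      ext y; simp
    rw [this, card_insert_of_notMem (by simpa using h)]
    simp
  · have : slice (insert (i, x) A) j = slice A j := by
      ext y; simp [hj]
    rw [this]; simp [hj]

theorem gadgets (P : Par k δ α β) (H : Hyp E δ α) (hn : 3 ≤ β * n)
    (ε : ℝ) (hε : 0 < ε) (hε1 : ε + β ≤ 1) (B q : ℕ)
    (hF : (k * q : ℝ) * (4 * k * (B + 1)) ≤ β * n)
    (hbig : 4 * k * (B + 1) < δ ^ 2 / 4 * (ε * n))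
    (hpow : (1 - δ ^ 2 / 4) ^ (B + 1) ≤ ε) :
    ∃ (A : ZMod k × Fin q → Finset (ZMod k × Fin n)) (Q : ZMod k × Fin q → Finset (Fin n)),
      (∀ z, (A z).card ≤ 4 * k * (B + 1)) ∧ (∀ z w, z ≠ w → Disjoint (A z) (A w)) ∧
      (∀ z, Acc E z.1 (A z) (Q z)) ∧
      (∀ z, ∃ t, ∀ j, (slice (A z) j).card + (if j = z.1 then 1 else 0) = t) ∧
      ∀ z, ((univ.filter fun x => (∀ w, (z.1, x) ∉ A w) ∧ x ∉ Q z).card : ℝ) ≤ ε * n := by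
  have : NeZero k := ⟨by have := P.hk; omega⟩
  have key : ∀ s : Finset (ZMod k × Fin q),
    ∃ (A : ZMod k × Fin q → Finset (ZMod k × Fin n)) (Q : ZMod k × Fin q → Finset (Fin n)),
      (∀ z ∈ s, (A z).card ≤ 4 * k * (B + 1)) ∧ (∀ z ∈ s, ∀ w ∈ s, z ≠ w → Disjoint (A z) (A w)) ∧
      (∀ z ∈ s, Acc E z.1 (A z) (Q z)) ∧
      (∀ z ∈ s, ∃ t, ∀ j, (slice (A z) j).card + (if j = z.1 then 1 else 0) = t) ∧
      ∀ z ∈ s, ((univ.filter fun x => (∀ w ∈ s, (z.1, x) ∉ A w) ∧ x ∉ Q z).card : ℝ) ≤ ε * n := by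
    intro s
    induction s using Finset.induction_on with
    | empty => exact ⟨fun _ => ∅, fun _ => ∅, by simp⟩
    | insert z0 s hz0 ih =>
      obtain ⟨A, Q, h1, h2, h3, h4, h5⟩ := ih
      have hcard : (insert z0 s).card ≤ k * q := by
        refine (card_le_univ _).trans ?_
        rw [Fintype.card_prod, ZMod.card, Fintype.card_fin]
      rw [card_insert_of_notMem hz0] at hcard
      have hFc : (s.biUnion A).card ≤ s.card * (4 * k * (B + 1)) := card_biUnion_le_card_mul _ _ _ h1
      obtain ⟨A0, Q0, g1, g2, g3, g4, g5, g6⟩ := gadget P H hn (s.biUnion A) z0.1 ε hε hε1 B (by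
        intro j
        have h6 := card_slice_le (s.biUnion A) j
        have h7 : (slice (s.biUnion A) j).card + 4 * k * (B + 1) ≤ k * q * (4 * k * (B + 1)) := by
          calc _ ≤ s.card * (4 * k * (B + 1)) + 4 * k * (B + 1) := by omega
            _ = (s.card + 1) * (4 * k * (B + 1)) := by ring
            _ ≤ _ := by gcongr
        have h8 : ((slice (s.biUnion A) j).card : ℝ) + 4 * k * (B + 1) ≤ k * q * (4 * k * (B + 1)) := by
          exact_mod_cast h7
        linarith) hbig
      have hne : ∀ z ∈ s, z ≠ z0 := by rintro z hz rfl; exact hz0 hz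
      have hdis : ∀ z ∈ s, Disjoint A0 (A z) := by
        intro z hz
        exact (Finset.disjoint_biUnion_right _ _ _).1 g1 z hz
      have hup : ∀ z ∈ s, Function.update A z0 A0 z = A z := fun z hz => Function.update_of_ne (hne z hz) _ _
      have hupQ : ∀ z ∈ s, Function.update Q z0 Q0 z = Q z := fun z hz => Function.update_of_ne (hne z hz) _ _
      refine ⟨Function.update A z0 A0, Function.update Q z0 Q0, ?_, ?_, ?_, ?_, ?_⟩
      · intro z hz
        rcases mem_insert.1 hz with rfl | hz
        · simpa using g2
        · rw [hup z hz]; exact h1 z hz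
      · intro z hz w hw hzw
        rcases mem_insert.1 hz with h | hz1 <;> rcases mem_insert.1 hw with h' | hw1
        · exact absurd (h.trans h'.symm) hzw
        · rw [hup w hw1, h, Function.update_self]; exact hdis w hw1
        · rw [hup z hz1, h', Function.update_self]; exact (hdis z hz1).symm
        · rw [hup z hz1, hup w hw1]; exact h2 z hz1 w hw1 hzw
      · intro z hz
        rcases mem_insert.1 hz with rfl | hz
        · simpa using g3
        · rw [hup z hz, hupQ z hz]; exact h3 z hz
      · intro z hz
        rcases mem_insert.1 hz with rfl | hz
        · rw [Function.update_self]
          obtain ⟨x, hx, hxA⟩ := exists_not_slice A0 z.1 Q0 (by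
            have : (A0.card : ℝ) ≤ 4 * k * (B + 1) := by exact_mod_cast g2
            have : (A0.card : ℝ) < Q0.card := by linarith
            exact_mod_cast this)
          obtain ⟨t, ht⟩ := (g3 x hx hxA).card
          refine ⟨t, fun j => ?_⟩
          rw [← ht j, card_slice_insert hxA]
        · rw [hup z hz]; exact h4 z hz
      · intro z hz
        rcases mem_insert.1 hz with rfl | hz
        · have hsub : (univ.filter fun x => (∀ w ∈ insert z s, (z.1, x) ∉ Function.update A z A0 w) ∧
              x ∉ Function.update Q z Q0 z) ⊆ (univ.filter fun x => (z.1, x) ∉ s.biUnion A ∧ x ∉ Q0) := by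
            intro x hx
            simp only [mem_filter, mem_univ, true_and, Function.update_self, mem_biUnion, not_exists, not_and] at hx ⊢
            refine ⟨fun w hw => ?_, hx.2⟩
            have := hx.1 w (mem_insert_of_mem hw)
            rwa [hup w hw] at this
          have h6 : ((univ.filter fun x => (∀ w ∈ insert z s, (z.1, x) ∉ Function.update A z A0 w) ∧
              x ∉ Function.update Q z Q0 z).card : ℝ) ≤ (univ.filter fun x => (z.1, x) ∉ s.biUnion A ∧ x ∉ Q0).card := by
            exact_mod_cast card_le_card hsub
          refine h6.trans ?_
          rcases g6 with g | g
          · exact g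
          · exact g.trans (mul_le_mul_of_nonneg_right hpow (by positivity))
        · refine le_trans ?_ (h5 z hz)
          norm_cast
          apply card_le_card
          intro x hx
          simp only [mem_filter, mem_univ, true_and] at hx ⊢
          rw [hupQ z hz] at hx
          refine ⟨fun w hw => ?_, hx.2⟩
          have := hx.1 w (mem_insert_of_mem hw)
          rwa [hup w hw] at this
  obtain ⟨A, Q, h1, h2, h3, h4, h5⟩ := key univ
  exact ⟨A, Q, fun z => h1 z (mem_univ _), fun z w => h2 z (mem_univ _) w (mem_univ _),
    fun z => h3 z (mem_univ _), fun z => h4 z (mem_univ _), fun z => by simpa using h5 z (mem_univ _)⟩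

/-- cover a small exceptional set by disjoint cycles avoiding `F` -/
theorem cover (P : Par k δ α β) (H : Hyp E δ α) (F : Finset (ZMod k × Fin n)) (m : ℕ)
    (hF : ∀ j, ((slice F j).card : ℝ) + m ≤ 2 * β * n)
    (X : Finset (ZMod k × Fin n)) (hXF : Disjoint X F) (hX : X.card ≤ m) :
    ∃ C, Tile E C ∧ Disjoint C F ∧ X ⊆ C ∧ ∀ j, (slice C j).card ≤ m := by
  have : NeZero k := ⟨by have := P.hk; omega⟩
  have hα := P.hα
  have hαβ := P.hαβ
  have hβδ := P.hβδ
  have hδ := P.hδ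
  have hkp := P.two_pos
  suffices h : ∀ Y ⊆ X, ∃ C, Tile E C ∧ Disjoint C F ∧ Y ⊆ C ∧ ∀ j, (slice C j).card ≤ Y.card by
    obtain ⟨C, h1, h2, h3, h4⟩ := h X subset_rfl
    exact ⟨C, h1, h2, h3, fun j => (h4 j).trans hX⟩
  intro Y
  induction Y using Finset.induction_on with
  | empty =>
    intro _
    exact ⟨∅, Tile.empty, by simp, by simp, by simp [slice]⟩
  | insert z Y hz ih =>
    intro hsub
    obtain ⟨C, h1, h2, h3, h4⟩ := ih ((subset_insert _ _).trans hsub)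
    by_cases hzC : z ∈ C
    · refine ⟨C, h1, h2, insert_subset hzC h3, fun j => (h4 j).trans (card_le_card (subset_insert _ _))⟩
    obtain ⟨i, v⟩ := z
    have hsl : ∀ j, ((slice (F ∪ C) j).card : ℝ) ≤ 2 * β * n := by
      intro j
      have a1 := card_slice_union_le F C j
      have a2 := h4 j
      have a3 := card_le_card ((subset_insert _ _).trans hsub)
      have : ((slice (F ∪ C) j).card : ℝ) ≤ (slice F j).card + m := by
        exact_mod_cast a1.trans (by omega)
      exact this.trans (hF j)
    have hn0 : (0:ℝ) ≤ n := by positivity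
    have e1 : α * n ≤ β * n := mul_le_mul_of_nonneg_right hαβ hn0
    have e2 : 8 * β * n ≤ δ * n := mul_le_mul_of_nonneg_right (by linarith) hn0
    have e3 : δ * n ≤ n := by nlinarith
    have e4 : 0 ≤ β * n := mul_nonneg (by linarith) hn0
    have hcc : ∀ j, ((((slice (F ∪ C) j)ᶜ)ᶜ).card : ℝ) ≤ 2 * β * n := by
      intro j; rw [compl_compl]; exact hsl j
    obtain ⟨c, hc, hci, hcA⟩ := cyc_vertex P.hk H i v (fun j => (slice (F ∪ C) j)ᶜ)
      (fun j => by
        have := card_ge ((slice (F ∪ C) j)ᶜ)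
        have := hcc j
        linarith)
      (by
        have := card_filter_ge ((slice (F ∪ C) (i+1))ᶜ) (fun b => E i v b)
        have := hcc (i+1)
        have := H.out i v
        linarith)
      (by
        have := card_filter_ge ((slice (F ∪ C) (i-1))ᶜ) (fun b => E (i-1) b v)
        have := hcc (i-1)
        have := H.inn (i-1) v
        linarith)
    have hiF : (i, v) ∉ F := Finset.disjoint_left.1 hXF (hsub (mem_insert_self _ _))
    have hcFC : ∀ j, (j, c j) ∉ F ∪ C := by
      intro j
      by_cases hj : j = i
      · subst hj
        rw [hci, mem_union]
        tauto
      · have := hcA j hj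
        simpa using this
    have hd : Disjoint (verts c) (F ∪ C) := by
      rw [Finset.disjoint_left]
      rintro ⟨j, x⟩ hx
      rw [mem_verts] at hx
      subst hx
      exact hcFC j
    rw [disjoint_union_right] at hd
    refine ⟨verts c ∪ C, (tile_verts hc).union h1 hd.2, disjoint_union_left.2 ⟨hd.1, h2⟩, ?_, ?_⟩
    · apply insert_subset
      · exact mem_union_left _ (mem_verts.2 hci)
      · exact h3.trans subset_union_right
    · intro j
      rw [card_insert_of_notMem hz]
      have a1 := card_slice_union_le (verts c) C j
      have a2 : (slice (verts c) j).card ≤ 1 := by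
        rw [card_le_one]
        intro a ha b hb
        rw [mem_slice, mem_verts] at ha hb
        exact ha.symm.trans hb
      have := h4 j
      omega

end TCF

namespace TCF
open Finset
open scoped Classical

variable {k n : ℕ} {E : ZMod k → Fin n → Fin n → Prop} {δ α β : ℝ}

theorem dens_left {S Z : Finset (Fin n)} {R : Fin n → Fin n → Prop} {t d : ℝ} (hd : 0 ≤ d)
    (h : ∀ x ∈ S, d ≤ ((Z.filter fun y => R x y).card : ℝ)) (ht : t ≤ (S.card : ℝ)) :
    t * d ≤ ∑ x ∈ S, ((Z.filter fun y => R x y).card : ℝ) := by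
  have := Finset.card_nsmul_le_sum S _ d h
  rw [nsmul_eq_mul] at this
  exact (mul_le_mul_of_nonneg_right ht hd).trans this

theorem sum_swap (S Z : Finset (Fin n)) (R : Fin n → Fin n → Prop) :
    ∑ x ∈ S, ((Z.filter fun y => R x y).card : ℝ) = ∑ z ∈ Z, ((S.filter fun x => R x z).card : ℝ) := by
  have : ∑ x ∈ S, (Z.filter fun y => R x y).card = ∑ z ∈ Z, (S.filter fun x => R x z).card := by
    simp only [card_filter]
    exact Finset.sum_comm
  exact_mod_cast this

theorem dens_right {S Z : Finset (Fin n)} {R : Fin n → Fin n → Prop} {t d : ℝ} (hd : 0 ≤ d)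
    (h : ∀ z ∈ Z, d ≤ ((S.filter fun x => R x z).card : ℝ)) (ht : t ≤ (Z.card : ℝ)) :
    t * d ≤ ∑ x ∈ S, ((Z.filter fun y => R x y).card : ℝ) := by
  rw [sum_swap]
  exact dens_left (R := fun z x => R x z) hd h ht

theorem filter_sdiff_ge (W Y U : Finset (Fin n)) (p : Fin n → Prop) :
    ((W.filter p).card : ℝ) - Y.card - U.card ≤ (((W \ (Y ∪ U)).filter p).card : ℝ) := by
  have : W.filter p ⊆ ((W \ (Y ∪ U)).filter p) ∪ (Y ∪ U) := by
    intro x hx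
    simp only [mem_union, mem_filter, mem_sdiff] at hx ⊢
    tauto
  have h1 := (card_le_card this).trans ((card_union_le _ _).trans (Nat.add_le_add_left (card_union_le _ _) _))
  have : ((W.filter p).card : ℝ) ≤ ((W \ (Y ∪ U)).filter p).card + (Y.card + U.card) := by exact_mod_cast h1
  linarith

def used (T : Finset (ZMod k → Fin n)) (j : ZMod k) : Finset (Fin n) := T.image fun c => c j

theorem used_insert (T : Finset (ZMod k → Fin n)) (c : ZMod k → Fin n) (j : ZMod k) :
    used (insert c T) j = insert (c j) (used T j) := by
  simp [used, image_insert]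

/-- edge count in a slot -/
theorem slot_sum {Yl Yr Wl Wr Ul Ur : Finset (Fin n)} {R : Fin n → Fin n → Prop} {A B : Finset (Fin n)}
    {η θ : ℝ} (hη : 0 ≤ η) {s N : ℝ} (hs1 : (Yl.card : ℝ) ≤ s) (hs2 : (Yr.card : ℝ) ≤ s)
    (hu1 : (Ul.card : ℝ) ≤ N) (hu2 : (Ur.card : ℝ) ≤ N) (hsN : s + N ≤ η * n / 2)
    (hl : ∀ y ∈ Yl, η * n ≤ ((Wr.filter fun x => R y x).card : ℝ))
    (hr : ∀ y ∈ Yr, η * n ≤ ((Wl.filter fun x => R x y).card : ℝ))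
    (hc : (A = Yl \ Ul ∧ B = Wr \ (Yr ∪ Ur) ∧ θ * n ≤ (A.card : ℝ)) ∨
      (A = Wl \ (Yl ∪ Ul) ∧ B = Yr \ Ur ∧ θ * n ≤ (B.card : ℝ))) :
    θ * n * (η * n / 2) ≤ ∑ x ∈ A, ((B.filter fun y => R x y).card : ℝ) := by
  rcases hc with ⟨hA, hB, ht⟩ | ⟨hA, hB, ht⟩
  · apply dens_left (by positivity) _ ht
    intro x hx
    rw [hA] at hx
    have h1 := hl x (mem_sdiff.1 hx).1
    have h2 := filter_sdiff_ge Wr Yr Ur (fun y => R x y)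
    rw [hB]
    linarith
  · apply dens_right (by positivity) _ ht
    intro x hx
    rw [hB] at hx
    have h1 := hr x (mem_sdiff.1 hx).1
    have h2 := filter_sdiff_ge Wl Yl Ul (fun y => R y x)
    rw [hA]
    linarith

theorem choose_side {Ya Yb Ua Ub : Finset (Fin n)} {s m u : ℕ} {θ : ℝ}
    (ha : Ya.card = s) (hb : Yb.card = s) (hu : (Ua ∩ Ya).card + (Ub ∩ Yb).card ≤ u) (hum : u < m)
    (hθ : m + 2 * θ * n ≤ 2 * (s : ℝ)) :
    θ * n ≤ ((Ya \ Ua).card : ℝ) ∨ θ * n ≤ ((Yb \ Ub).card : ℝ) := by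
  have h1 := card_sdiff_add_card_inter Ya Ua
  have h2 := card_sdiff_add_card_inter Yb Ub
  rw [inter_comm] at h1 h2
  have h3 : 2 * s ≤ (Ya \ Ua).card + (Yb \ Ub).card + m := by omega
  have h4 : 2 * (s : ℝ) ≤ (Ya \ Ua).card + (Yb \ Ub).card + m := by exact_mod_cast h3
  by_contra hcon
  push Not at hcon
  linarith

set_option maxHeartbeats 1000000 in
theorem rebuild (P : Par k δ α β) (H : Hyp E δ α) (hn : 0 < n) (K : ℕ) (hK : k = 4 * K)
    (W Y : ZMod k → Finset (Fin n)) (s m : ℕ) (η θ : ℝ) (hη : 0 < η) (hη1 : η ≤ 1) (hθ0 : 0 < θ) (hθ1 : θ ≤ 1)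
    (hY : ∀ j, (Y j).card = s)
    (hdeg : ∀ e < 2 * K,
      (∀ y ∈ Y ((2 * e : ℕ) : ZMod k), η * n ≤
        (((W ((2 * e + 1 : ℕ) : ZMod k)).filter fun x => E ((2 * e : ℕ) : ZMod k) y x).card : ℝ)) ∧
      (∀ y ∈ Y ((2 * e + 1 : ℕ) : ZMod k), η * n ≤
        (((W ((2 * e : ℕ) : ZMod k)).filter fun x => E ((2 * e : ℕ) : ZMod k) x y).card : ℝ)))
    (hW : ∀ j, η * n ≤ ((W j).card : ℝ))
    (hsN : (s : ℝ) + K * m ≤ η * n / 2) (hθ : m + 2 * θ * n ≤ 2 * (s : ℝ))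
    (hα4 : 4 * α ≤ η * θ) (N : ℕ) (hN : N ≤ K * m) :
    ∃ (T : Finset (ZMod k → Fin n)) (u : ℕ → ℕ), Til E T ∧ T.card = N ∧
      (∀ c ∈ T, ∀ j, c j ∈ W j ∪ Y j) ∧ ∑ g ∈ range K, u g = N ∧
      ∀ g < K, ∀ r, (r = 0 ∨ r = 2) →
        (used T ((4 * g + r : ℕ) : ZMod k) ∩ Y ((4 * g + r : ℕ) : ZMod k)).card +
        (used T ((4 * g + (r + 1) : ℕ) : ZMod k) ∩ Y ((4 * g + (r + 1) : ℕ) : ZMod k)).card ≤ u g := by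
  induction N with
  | zero =>
    refine ⟨∅, fun _ => 0, ⟨by simp, by simp⟩, by simp, by simp, by simp, ?_⟩
    intro g hg r hr
    simp [used]
  | succ N ih =>
    obtain ⟨T, u, hT, hTc, hTW, hu, hslot⟩ := ih (by omega)
    have hn' : (0:ℝ) < n := by exact_mod_cast hn
    have hα := P.hα
    obtain ⟨g, hg, hgm⟩ : ∃ g < K, u g < m := by
      by_contra hcon
      push Not at hcon
      have : ∑ g ∈ range K, m ≤ ∑ g ∈ range K, u g :=
        Finset.sum_le_sum (fun g hg => hcon g (mem_range.1 hg))
      rw [sum_const, card_range, smul_eq_mul, hu] at this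
      omega
    have hus : ∀ j, ((used T j).card : ℝ) = N := by
      intro j
      rw [used, hT.card_image, hTc]
    have hNm : (N : ℝ) ≤ K * m := by exact_mod_cast (by omega : N ≤ K * m)
    have hsN' : (s : ℝ) + N ≤ η * n / 2 := by linarith
    have hYr : ∀ j, ((Y j).card : ℝ) ≤ s := fun j => by rw [hY]
    obtain ⟨ra, hra, hrac⟩ : ∃ ra, (ra = 0 ∨ ra = 1) ∧
        θ * n ≤ ((Y ((4 * g + ra : ℕ) : ZMod k) \ used T ((4 * g + ra : ℕ) : ZMod k)).card : ℝ) := by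
      rcases choose_side (hY _) (hY _) (hslot g hg 0 (Or.inl rfl)) hgm hθ with h | h
      · exact ⟨0, Or.inl rfl, h⟩
      · exact ⟨1, Or.inr rfl, h⟩
    obtain ⟨rb, hrb, hrbc⟩ : ∃ rb, (rb = 2 ∨ rb = 3) ∧
        θ * n ≤ ((Y ((4 * g + rb : ℕ) : ZMod k) \ used T ((4 * g + rb : ℕ) : ZMod k)).card : ℝ) := by
      rcases choose_side (hY _) (hY _) (hslot g hg 2 (Or.inr rfl)) hgm hθ with h | h
      · exact ⟨2, Or.inl rfl, h⟩
      · exact ⟨3, Or.inr rfl, h⟩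
    set a : ZMod k := ((4 * g + ra : ℕ) : ZMod k) with ha
    set b : ZMod k := ((4 * g + rb : ℕ) : ZMod k) with hb
    set A : ZMod k → Finset (Fin n) := fun j => if j = a ∨ j = b then Y j \ used T j
      else W j \ (Y j ∪ used T j) with hA
    have hne : ∀ g' < K, ∀ r < 4, ∀ r' < 4, (g' ≠ g ∨ r ≠ r') →
        ((4 * g' + r : ℕ) : ZMod k) ≠ ((4 * g + r' : ℕ) : ZMod k) := by
      intro g' hg' r hr r' hr' h
      apply natCast_ne <;> omega
    have hAD : ∀ j, j = a ∨ j = b → A j = Y j \ used T j := fun j hj => by simp only [hA, if_pos hj]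
    have hAN : ∀ j, j ≠ a → j ≠ b → A j = W j \ (Y j ∪ used T j) := fun j hj hj' => by
      simp only [hA]
      rw [if_neg (by tauto)]
    have h2θ : 2 * α * n ≤ θ * n := mul_le_mul_of_nonneg_right (by nlinarith) hn'.le
    have h2η : 2 * α * n ≤ η * n / 2 := by
      have : 4 * α * n ≤ η * n := mul_le_mul_of_nonneg_right (by nlinarith) hn'.le
      linarith
    have hAcard : ∀ j, 2 * α * n ≤ ((A j).card : ℝ) := by
      intro j
      by_cases h1 : j = a
      · rw [hAD j (Or.inl h1), h1]; linarith
      by_cases h2 : j = b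
      · rw [hAD j (Or.inr h2), h2]; linarith
      rw [hAN j h1 h2]
      have h3 := filter_sdiff_ge (W j) (Y j) (used T j) (fun _ => True)
      simp only [filter_true] at h3
      have h4 := hW j
      have h5 := hYr j
      have h6 := hus j
      linarith
    have hprod : 2 * α * n * n ≤ θ * n * (η * n / 2) := by
      have : 4 * α * (n * n) ≤ η * θ * (n * n) := mul_le_mul_of_nonneg_right hα4 (by positivity)
      linarith
    have c0 : ((4 * g : ℕ) : ZMod k) = ((4 * g + 0 : ℕ) : ZMod k) := by simp
    have c1 : ((4 * g : ℕ) : ZMod k) + 1 = ((4 * g + 1 : ℕ) : ZMod k) := by push_cast; ring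
    have c2 : ((4 * g : ℕ) : ZMod k) + 2 = ((4 * g + 2 : ℕ) : ZMod k) := by push_cast; ring
    have c3 : ((4 * g : ℕ) : ZMod k) + 3 = ((4 * g + 3 : ℕ) : ZMod k) := by push_cast; ring
    have hd0 := hdeg (2 * g) (by omega)
    have hd1 := hdeg (2 * g + 1) (by omega)
    rw [show 2 * (2 * g) = 4 * g + 0 by ring, show 4 * g + 0 + 1 = 4 * g + 1 by ring] at hd0
    rw [show 2 * (2 * g + 1) = 4 * g + 2 by ring, show 4 * g + 2 + 1 = 4 * g + 3 by ring] at hd1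
    have hsum1 : θ * n * (η * n / 2) ≤ ∑ x ∈ A ((4 * g + 0 : ℕ) : ZMod k),
        (((A ((4 * g + 1 : ℕ) : ZMod k)).filter fun y => E ((4 * g + 0 : ℕ) : ZMod k) x y).card : ℝ) := by
      refine slot_sum (R := fun x y => E ((4 * g + 0 : ℕ) : ZMod k) x y) hη.le (hYr _) (hYr _)
        (hus ((4 * g + 0 : ℕ) : ZMod k)).le (hus ((4 * g + 1 : ℕ) : ZMod k)).le hsN' hd0.1 hd0.2 ?_
      rcases hra with h | h
      · left
        have e0 : ((4 * g + 0 : ℕ) : ZMod k) = a := by rw [ha, h]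
        have e2 := hAN ((4 * g + 1 : ℕ) : ZMod k) (hne g hg 1 (by omega) ra (by omega) (Or.inr (by omega)))
          (hne g hg 1 (by omega) rb (by omega) (Or.inr (by omega)))
        rw [e0, hAD a (Or.inl rfl)]
        exact ⟨rfl, e2, hrac⟩
      · right
        have e0 : ((4 * g + 1 : ℕ) : ZMod k) = a := by rw [ha, h]
        have e2 := hAN ((4 * g + 0 : ℕ) : ZMod k) (hne g hg 0 (by omega) ra (by omega) (Or.inr (by omega)))
          (hne g hg 0 (by omega) rb (by omega) (Or.inr (by omega)))
        rw [e0, hAD a (Or.inl rfl)]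
        exact ⟨e2, rfl, hrac⟩
    have hsum2 : θ * n * (η * n / 2) ≤ ∑ x ∈ A ((4 * g + 2 : ℕ) : ZMod k),
        (((A ((4 * g + 3 : ℕ) : ZMod k)).filter fun y => E ((4 * g + 2 : ℕ) : ZMod k) x y).card : ℝ) := by
      refine slot_sum (R := fun x y => E ((4 * g + 2 : ℕ) : ZMod k) x y) hη.le (hYr _) (hYr _)
        (hus ((4 * g + 2 : ℕ) : ZMod k)).le (hus ((4 * g + 3 : ℕ) : ZMod k)).le hsN' hd1.1 hd1.2 ?_
      rcases hrb with h | h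
      · left
        have e0 : ((4 * g + 2 : ℕ) : ZMod k) = b := by rw [hb, h]
        have e2 := hAN ((4 * g + 3 : ℕ) : ZMod k) (hne g hg 3 (by omega) ra (by omega) (Or.inr (by omega)))
          (hne g hg 3 (by omega) rb (by omega) (Or.inr (by omega)))
        rw [e0, hAD b (Or.inr rfl)]
        exact ⟨rfl, e2, hrbc⟩
      · right
        have e0 : ((4 * g + 3 : ℕ) : ZMod k) = b := by rw [hb, h]
        have e2 := hAN ((4 * g + 2 : ℕ) : ZMod k) (hne g hg 2 (by omega) ra (by omega) (Or.inr (by omega)))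
          (hne g hg 2 (by omega) rb (by omega) (Or.inr (by omega)))
        rw [e0, hAD b (Or.inr rfl)]
        exact ⟨e2, rfl, hrbc⟩
    rw [sum_swap] at hsum2
    rw [← c1, ← c0] at hsum1
    rw [← c2, ← c3] at hsum2
    obtain ⟨c, hc, hcA⟩ := cyc_dense P.hk H hα hn ((4 * g : ℕ) : ZMod k) A hAcard
      (hprod.trans hsum1) (hprod.trans hsum2)
    have hcu : ∀ j, c j ∉ used T j := by
      intro j
      have := hcA j
      by_cases h : j = a ∨ j = b
      · rw [hAD j h] at this; exact (mem_sdiff.1 this).2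
      · rw [hAN j (by tauto) (by tauto)] at this
        have := (mem_sdiff.1 this).2
        rw [mem_union] at this
        tauto
    have hcW : ∀ j, c j ∈ W j ∪ Y j := by
      intro j
      have := hcA j
      by_cases h : j = a ∨ j = b
      · rw [hAD j h] at this; exact mem_union_right _ (mem_sdiff.1 this).1
      · rw [hAN j (by tauto) (by tauto)] at this
        exact mem_union_left _ (mem_sdiff.1 this).1
    have hcd : ∀ c' ∈ T, ∀ j, c' j ≠ c j := by
      intro c' hc' j h
      exact hcu j (h ▸ mem_image_of_mem _ hc')
    have hcT : c ∉ T := fun h => hcd c h 0 rfl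
    have hinc : ∀ j, (used (insert c T) j ∩ Y j).card ≤ (used T j ∩ Y j).card + 1 := by
      intro j
      rw [used_insert]
      refine (card_le_card (t := insert (c j) (used T j ∩ Y j)) (fun x hx => by
        simp only [mem_inter, mem_insert] at hx ⊢; tauto)).trans ?_
      exact card_insert_le _ _
    have hsame : ∀ j, j ≠ a → j ≠ b → (used (insert c T) j ∩ Y j).card = (used T j ∩ Y j).card := by
      intro j h1 h2
      have := hcA j
      rw [hAN j h1 h2, mem_sdiff, mem_union] at this
      rw [used_insert, insert_inter_of_notMem (by tauto)]
    refine ⟨insert c T, Function.update u g (u g + 1), ⟨?_, ?_⟩, ?_, ?_, ?_, ?_⟩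
    · intro c' hc'
      rcases mem_insert.1 hc' with rfl | h
      · exact hc
      · exact hT.1 _ h
    · intro x hx y hy hxy j
      rcases mem_insert.1 hx with h1 | h1 <;> rcases mem_insert.1 hy with h2 | h2
      · exact absurd (h1.trans h2.symm) hxy
      · rw [h1]; exact (hcd y h2 j).symm
      · rw [h2]; exact hcd x h1 j
      · exact hT.2 x h1 y h2 hxy j
    · rw [card_insert_of_notMem hcT, hTc]
    · intro c' hc'
      rcases mem_insert.1 hc' with rfl | h
      · exact hcW
      · exact hTW _ h
    · rw [Finset.sum_update_of_mem (mem_range.2 hg)]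
      have := Finset.add_sum_erase (range K) u (mem_range.2 hg)
      rw [sdiff_singleton_eq_erase]
      omega
    · intro g' hg' r hr
      by_cases hgg : g' = g
      · subst hgg
        rw [Function.update_self]
        have h0 := hslot g' hg r hr
        rcases hr with rfl | rfl
        · rcases hra with rfl | rfl
          · have e1 := hinc ((4 * g' + 0 : ℕ) : ZMod k)
            have e2 := hsame ((4 * g' + (0 + 1) : ℕ) : ZMod k) (hne g' hg _ (by omega) _ (by omega) (Or.inr (by omega)))
              (hne g' hg _ (by omega) _ (by omega) (Or.inr (by omega)))
            omega
          · have e1 := hinc ((4 * g' + (0 + 1) : ℕ) : ZMod k)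
            have e2 := hsame ((4 * g' + 0 : ℕ) : ZMod k) (hne g' hg _ (by omega) _ (by omega) (Or.inr (by omega)))
              (hne g' hg _ (by omega) _ (by omega) (Or.inr (by omega)))
            omega
        · rcases hrb with rfl | rfl
          · have e1 := hinc ((4 * g' + 2 : ℕ) : ZMod k)
            have e2 := hsame ((4 * g' + (2 + 1) : ℕ) : ZMod k) (hne g' hg _ (by omega) _ (by omega) (Or.inr (by omega)))
              (hne g' hg _ (by omega) _ (by omega) (Or.inr (by omega)))
            omega
          · have e1 := hinc ((4 * g' + (2 + 1) : ℕ) : ZMod k)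
            have e2 := hsame ((4 * g' + 2 : ℕ) : ZMod k) (hne g' hg _ (by omega) _ (by omega) (Or.inr (by omega)))
              (hne g' hg _ (by omega) _ (by omega) (Or.inr (by omega)))
            omega
      · rw [Function.update_of_ne hgg]
        have h0 := hslot g' hg' r hr
        have e1 := hsame ((4 * g' + r : ℕ) : ZMod k) (hne g' hg' _ (by omega) _ (by omega) (Or.inl hgg))
              (hne g' hg' _ (by omega) _ (by omega) (Or.inl hgg))
        have e2 := hsame ((4 * g' + (r + 1) : ℕ) : ZMod k) (hne g' hg' _ (by omega) _ (by omega) (Or.inl hgg))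
              (hne g' hg' _ (by omega) _ (by omega) (Or.inl hgg))
        omega

/-- sampling by types -/
theorem sample [NeZero k] (T : Finset (ZMod k → Fin n)) (Good : ZMod k → Fin n → Prop) (M : ℕ) (hM : M ≤ n)
    (hn : 0 < n) (hT : T.card ≤ n) :
    ∃ C ⊆ T, C.card ≤ M ∧ ∀ i, M * (T.filter fun c => Good i (c i)).card ≤
      n * ((C.filter fun c => Good i (c i)).card + 2 ^ k) := by
  set τ : (ZMod k → Fin n) → Finset (ZMod k) := fun c => univ.filter fun i => Good i (c i) with hτ
  have hD : ∀ t : Finset (ZMod k), ∃ D ⊆ T.filter (fun c => τ c = t),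
      D.card = (T.filter (fun c => τ c = t)).card * M / n := by
    intro t
    apply Finset.exists_subset_card_eq
    apply Nat.div_le_of_le_mul
    rw [mul_comm n]
    exact Nat.mul_le_mul_left _ hM
  choose D hD1 hD2 using hD
  have hfib : ∀ t, (T.filter fun c => c ∈ D (τ c)).filter (fun c => τ c = t) = D t := by
    intro t
    ext c
    simp only [mem_filter]
    constructor
    · rintro ⟨⟨_, h⟩, rfl⟩; exact h
    · intro h
      have := mem_filter.1 (hD1 t h)
      refine ⟨⟨this.1, ?_⟩, this.2⟩
      rw [this.2]; exact h
  refine ⟨T.filter fun c => c ∈ D (τ c), filter_subset _ _, ?_, ?_⟩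
  · rw [Finset.card_eq_sum_card_fiberwise (f := τ) (t := univ) (by intro x _; simp)]
    simp only [hfib, hD2]
    have h1 : n * ∑ t : Finset (ZMod k), ((T.filter (fun c => τ c = t)).card * M / n) ≤ n * M := by
      rw [Finset.mul_sum]
      calc _ ≤ ∑ t : Finset (ZMod k), (T.filter (fun c => τ c = t)).card * M :=
            Finset.sum_le_sum (fun t _ => Nat.mul_div_le _ _)
        _ = T.card * M := by
            rw [← Finset.sum_mul, ← Finset.card_eq_sum_card_fiberwise (f := τ) (t := univ) (by intro x _; simp)]
        _ ≤ n * M := Nat.mul_le_mul_right _ hT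
    exact Nat.le_of_mul_le_mul_left h1 hn
  · intro i
    have hg : ∀ c, Good i (c i) ↔ i ∈ τ c := by intro c; simp [hτ]
    have hsum : ∀ C : Finset (ZMod k → Fin n), (C.filter fun c => Good i (c i)).card =
        ∑ t ∈ univ.filter (fun t : Finset (ZMod k) => i ∈ t), (C.filter (fun c => τ c = t)).card := by
      intro C
      rw [Finset.card_eq_sum_card_fiberwise (f := τ) (t := univ.filter (fun t : Finset (ZMod k) => i ∈ t))]
      · apply Finset.sum_congr rfl
        intro t ht
        congr 1
        ext c
        simp only [mem_filter, mem_univ, true_and] at ht ⊢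
        rw [hg]
        constructor
        · rintro ⟨⟨h1, _⟩, h2⟩; exact ⟨h1, h2⟩
        · rintro ⟨h1, h2⟩; exact ⟨⟨h1, h2 ▸ ht⟩, h2⟩
      · intro c hc
        simp only [coe_filter, Set.mem_ofPred_eq, mem_univ, true_and] at hc ⊢
        exact (hg c).1 hc.2
    rw [hsum, hsum]
    simp only [hfib, hD2]
    rw [Finset.mul_sum]
    calc _ ≤ ∑ t ∈ univ.filter (fun t : Finset (ZMod k) => i ∈ t),
          n * ((T.filter (fun c => τ c = t)).card * M / n + 1) := by
          apply Finset.sum_le_sum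
          intro t _
          rw [mul_comm M]
          exact (Nat.lt_mul_div_succ _ hn).le
      _ = n * (∑ t ∈ univ.filter (fun t : Finset (ZMod k) => i ∈ t),
          ((T.filter (fun c => τ c = t)).card * M / n) + (univ.filter (fun t : Finset (ZMod k) => i ∈ t)).card) := by
          rw [← Finset.mul_sum, Finset.sum_add_distrib]; simp
      _ ≤ _ := by
          gcongr
          refine (card_le_univ _).trans ?_
          rw [Fintype.card_finset, ZMod.card]

theorem good_count (X Z : Finset (Fin n)) (R : Fin n → Fin n → Prop) {d η ζ : ℝ} (hη : 0 ≤ η) (hζ : 0 < ζ)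
    (hn : 0 < n) (hd : ∀ z ∈ Z, d ≤ ((X.filter fun x => R x z).card : ℝ)) (hZ : ζ * n ≤ (Z.card : ℝ)) :
    d - η / ζ * n ≤ ((X.filter fun x => η * n ≤ ((Z.filter fun z => R x z).card : ℝ)).card : ℝ) := by
  have hn' : (0:ℝ) < n := by exact_mod_cast hn
  have hZ0 : (0:ℝ) < Z.card := lt_of_lt_of_le (by positivity) hZ
  set Gd := X.filter fun x => η * n ≤ ((Z.filter fun z => R x z).card : ℝ) with hGd
  have h1 : (Z.card : ℝ) * d ≤ ∑ x ∈ X, ((Z.filter fun y => R x y).card : ℝ) := by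
    rw [sum_swap]
    have := Finset.card_nsmul_le_sum Z _ d hd
    rwa [nsmul_eq_mul] at this
  have h2 : ∑ x ∈ X, ((Z.filter fun y => R x y).card : ℝ) ≤
      ∑ x ∈ X, ((if x ∈ Gd then (Z.card : ℝ) else 0) + η * n) := by
    apply Finset.sum_le_sum
    intro x hx
    by_cases h : x ∈ Gd
    · rw [if_pos h]
      have : ((Z.filter fun y => R x y).card : ℝ) ≤ Z.card := by exact_mod_cast card_filter_le _ _
      have : 0 ≤ η * n := by positivity
      linarith
    · rw [if_neg h]
      have : ¬ (η * n ≤ ((Z.filter fun z => R x z).card : ℝ)) := by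
        intro h'; exact h (mem_filter.2 ⟨hx, h'⟩)
      linarith
  rw [Finset.sum_add_distrib, ← Finset.sum_filter] at h2
  have h3 : X.filter (fun x => x ∈ Gd) = Gd := by
    ext x; simp only [hGd, mem_filter]; tauto
  rw [h3, sum_const, sum_const, nsmul_eq_mul, nsmul_eq_mul] at h2
  have hX : (X.card : ℝ) ≤ n := by exact_mod_cast (card_le_univ _).trans (by simp)
  have h4 : (X.card : ℝ) * (η * n) ≤ n * (η * n) := mul_le_mul_of_nonneg_right hX (by positivity)
  have h5 : (n : ℝ) * (η * n) ≤ (η / ζ * n) * Z.card := by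
    have : (η / ζ * n) * (ζ * n) ≤ (η / ζ * n) * Z.card := mul_le_mul_of_nonneg_left hZ (by positivity)
    have e : (η / ζ * n) * (ζ * n) = n * (η * n) := by field_simp
    linarith
  have h6 : (Z.card : ℝ) * (d - η / ζ * n) ≤ Z.card * Gd.card := by nlinarith
  exact le_of_mul_le_mul_left h6 hZ0

end TCF

namespace TCF
open Finset
open scoped Classical

variable {k n : ℕ} {E : ZMod k → Fin n → Fin n → Prop} {δ α β : ℝ}

theorem mem_used {T : Finset (ZMod k → Fin n)} {j : ZMod k} {x : Fin n} :
    x ∈ used T j ↔ ∃ c ∈ T, c j = x := by simp [used]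

theorem arith_params {k n K : ℕ} {β ζ : ℝ} (hk : 4 ≤ k) (hK : k = 4 * K) (hβ : 0 < β) (hβ8 : β ≤ 1 / 8)
    (hδ1 : 2 / (k:ℝ) + 6 * β ≤ 1)
    (hζ : 0 < ζ) (hζ1 : ζ ≤ 1) (hN : (2:ℝ) ^ (k + 1) + 15 ≤ ζ * β ^ 2 * n) :
    ∃ M s m : ℕ, M ≤ n ∧ ((s : ℝ) ≤ (2 / (k:ℝ) + 6 * β) * M - 2 ^ k ∨ s = 0) ∧ M < K * m ∧
      (s : ℝ) + K * m ≤ (ζ * β) * n / 2 ∧ m + 2 * (ζ * β ^ 2 / 8) * n ≤ 2 * (s : ℝ) := by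
  set δ1 := 2 / (k:ℝ) + 6 * β with hδ1d
  have hk0 : (0:ℝ) < k := by exact_mod_cast (by omega : 0 < k)
  have hK0 : 0 < K := by omega
  have hn0 : (0:ℝ) ≤ n := by positivity
  have hδ0 : 0 < δ1 := by positivity
  set M := ⌊ζ * β / 8 * n⌋₊ with hM
  have hM1 : (M : ℝ) ≤ ζ * β / 8 * n := Nat.floor_le (by positivity)
  have hM2 : ζ * β / 8 * n - 1 < M := Nat.sub_one_lt_floor _
  set s := ⌊δ1 * M - 2 ^ k⌋₊ with hs
  have hs2 : δ1 * M - 2 ^ k - 1 < s := Nat.sub_one_lt_floor _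
  have hs1 : (s : ℝ) ≤ δ1 * M - 2 ^ k ∨ s = 0 := by
    by_cases h : 0 ≤ δ1 * M - 2 ^ k
    · left; exact Nat.floor_le h
    · right; exact Nat.floor_of_nonpos (by linarith)
  have hsM : (s : ℝ) ≤ M := by
    rcases hs1 with h | h
    · have h1 : δ1 * M ≤ 1 * M := mul_le_mul_of_nonneg_right hδ1 (by positivity)
      have h2 : (0:ℝ) ≤ 2 ^ k := by positivity
      linarith
    · rw [h]; simp
  have hζβ : 0 < ζ * β := by positivity
  have hζβ1 : ζ * β ≤ 1 := by nlinarith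
  refine ⟨M, s, M / K + 1, ?_, hs1, ?_, ?_, ?_⟩
  · have : (M : ℝ) ≤ n := by nlinarith
    exact_mod_cast this
  · exact Nat.lt_mul_div_succ M hK0
  · have h1 : K * (M / K + 1) ≤ M + K := by
      have := Nat.mul_div_le M K
      rw [mul_add]; omega
    have h2 : (K : ℝ) * ((M / K + 1 : ℕ) : ℝ) ≤ M + K := by exact_mod_cast h1
    have h3 : (K : ℝ) ≤ 2 ^ (k + 1) := by
      have : K ≤ 2 ^ (k + 1) := by
        have := @Nat.lt_two_pow_self (k+1)
        omega
      exact_mod_cast this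
    have h4 : ζ * β ^ 2 * n ≤ ζ * β / 8 * n := by
      apply mul_le_mul_of_nonneg_right _ hn0
      nlinarith
    linarith
  · have h1 : ((M / K : ℕ) : ℝ) ≤ (M : ℝ) / K := Nat.cast_div_le
    have h2 : (M : ℝ) / K = 2 * (2 / (k:ℝ)) * M := by
      rw [hK]; push_cast
      have : (K:ℝ) ≠ 0 := by positivity
      field_simp
      norm_num
    have h3 : (2:ℝ) ^ (k + 1) = 2 * 2 ^ k := by ring
    have h4 : 12 * β * (ζ * β / 8 * n - 1) ≤ 12 * β * M := by
      apply mul_le_mul_of_nonneg_left hM2.le (by positivity)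
    push_cast
    have h5 : δ1 * M = 2 / (k:ℝ) * M + 6 * β * M := by rw [hδ1d]; ring
    have h6 : 12 * β * (ζ * β / 8 * n - 1) = 12 / 8 * (ζ * β ^ 2 * n) - 12 * β := by ring
    have h7 : 2 * (ζ * β ^ 2 / 8) * n = 2 / 8 * (ζ * β ^ 2 * n) := by ring
    have h8 : (0:ℝ) < 2 ^ k := by positivity
    rw [h7]
    rw [h6] at h4
    rw [h2] at h1
    linarith

set_option maxHeartbeats 1000000 in
theorem almost (P : Par k δ α β) (H : Hyp E δ α) (hn : 0 < n) (F : Finset (ZMod k × Fin n)) (f : ℕ)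
    (hFf : ∀ j, (slice F j).card = f) (hf : (f : ℝ) ≤ β * n) (ζ : ℝ) (hζ : 0 < ζ) (hζ1 : ζ ≤ 1)
    (hα32 : 32 * α ≤ ζ ^ 2 * β ^ 3) (hN : (2:ℝ) ^ (k + 1) + 15 ≤ ζ * β ^ 2 * n) :
    ∃ T, Til E T ∧ (∀ c ∈ T, ∀ j, (j, c j) ∉ F) ∧ (n : ℝ) ≤ f + T.card + ζ * n := by
  have hk := P.hk
  have : NeZero k := ⟨by omega⟩
  have hα := P.hα
  have hαβ := P.hαβ
  have hβδ := P.hβδ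
  have hδ := P.hδ
  have hkp := P.two_pos
  have hn' : (0:ℝ) < n := by exact_mod_cast hn
  have hβ : 0 < β := by linarith
  obtain ⟨K, hK⟩ := P.hk4
  obtain ⟨T, hTm, hTmax⟩ := Finset.exists_max_image
    (univ.filter fun T : Finset (ZMod k → Fin n) => Til E T ∧ ∀ c ∈ T, ∀ j, (j, c j) ∉ F) Finset.card
    ⟨∅, mem_filter.2 ⟨mem_univ _, ⟨by simp, by simp⟩, by simp⟩⟩
  simp only [mem_filter, mem_univ, true_and] at hTm hTmax
  obtain ⟨hT, hTF⟩ := hTm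
  refine ⟨T, hT, hTF, ?_⟩
  by_contra hcon
  push Not at hcon
  set X : ZMod k → Finset (Fin n) := fun j => (slice F j)ᶜ with hX
  set W : ZMod k → Finset (Fin n) := fun j => X j \ used T j with hW
  have husX : ∀ j, used T j ⊆ X j := by
    intro j x hx
    obtain ⟨c, hc, rfl⟩ := mem_used.1 hx
    simpa [hX] using hTF c hc j
  have huc : ∀ j, (used T j).card = T.card := fun j => hT.card_image j
  have hXc : ∀ j, ((X j)ᶜ.card : ℝ) = f := by
    intro j; simp only [hX, compl_compl, hFf]
  have hWc : ∀ j, ζ * n ≤ ((W j).card : ℝ) := by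
    intro j
    rw [hW]; simp only
    rw [cast_card_sdiff (husX j), huc j]
    have h1 := card_ge (X j)
    rw [hXc] at h1
    linarith
  set η := ζ * β with hη
  have hη0 : 0 < η := by positivity
  set Good : ZMod k → Fin n → Prop := fun j v => if Even j.val then
    η * n ≤ (((W (j+1)).filter fun x => E j v x).card : ℝ) else
    η * n ≤ (((W (j-1)).filter fun x => E (j-1) x v).card : ℝ) with hGood
  set δ1 := 2 / (k:ℝ) + 6 * β with hδ1
  have hGc : ∀ j, δ1 * n ≤ (((X j).filter fun v => Good j v).card : ℝ) := by
    intro j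
    have hηζ : η / ζ = β := by rw [hη]; field_simp
    have hle : δ1 * n ≤ (δ * n - β * n) - η / ζ * n := by
      rw [hηζ]
      have : δ1 * n ≤ (δ - 2 * β) * n := mul_le_mul_of_nonneg_right (by linarith) hn'.le
      linarith
    by_cases hj : Even j.val
    · have h1 := good_count (X j) (W (j+1)) (fun x z => E j x z) (d := δ * n - β * n) hη0.le hζ hn (by
        intro z hz
        have h1 := card_filter_ge (X j) (fun x => E j x z)
        have h2 := H.inn j z
        rw [hXc] at h1
        linarith) (hWc _)
      simp only [hGood, if_pos hj]
      exact hle.trans h1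
    · have h1 := good_count (X j) (W (j-1)) (fun x z => E (j-1) z x) (d := δ * n - β * n) hη0.le hζ hn (by
        intro z hz
        have h1 := card_filter_ge (X j) (fun x => E (j-1) z x)
        have h2 := H.out (j-1) z
        rw [hXc] at h1
        linarith) (hWc _)
      simp only [hGood, if_neg hj]
      exact hle.trans h1
  have hβ8 : β ≤ 1 / 8 := by linarith
  obtain ⟨M, s, m, hMn, hs, hMm, hsm, hms⟩ := arith_params (n := n) hk hK hβ hβ8 (by linarith) hζ hζ1 hN
  have hTn : T.card ≤ n := by
    rw [← huc 0]; exact (card_le_univ _).trans (by simp)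
  obtain ⟨C, hCT, hCM, hC⟩ := sample T Good M hMn hn hTn
  set Z : ZMod k → Finset (Fin n) := fun j => ((X j).filter fun v => Good j v).filter
    fun v => v ∈ W j ∨ v ∈ used C j with hZ
  have hsZ : ∀ j, s ≤ (Z j).card := by
    intro j
    rcases hs with hs | hs
    swap
    · omega
    have h1 : ((X j).filter fun v => Good j v).card ≤ ((W j).filter fun v => Good j v).card +
        (T.filter fun c => Good j (c j)).card := by
      have : ((X j).filter fun v => Good j v) ⊆ ((W j).filter fun v => Good j v) ∪
        ((T.filter fun c => Good j (c j)).image fun c => c j) := by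
        intro x hx
        obtain ⟨hx1, hx2⟩ := mem_filter.1 hx
        by_cases hu : x ∈ used T j
        · apply mem_union_right
          obtain ⟨c, hc, rfl⟩ := mem_used.1 hu
          exact mem_image.2 ⟨c, mem_filter.2 ⟨hc, hx2⟩, rfl⟩
        · apply mem_union_left
          exact mem_filter.2 ⟨mem_sdiff.2 ⟨hx1, hu⟩, hx2⟩
      exact (card_le_card this).trans ((card_union_le _ _).trans (Nat.add_le_add_left card_image_le _))
    have h2 : ((W j).filter fun v => Good j v).card + (C.filter fun c => Good j (c j)).card ≤ (Z j).card := by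
      have hinj : ((C.filter fun c => Good j (c j)).image fun c => c j).card = (C.filter fun c => Good j (c j)).card := by
        apply card_image_of_injOn
        intro c hc c' hc' h
        by_contra hne
        exact hT.2 c (hCT (mem_filter.1 hc).1) c' (hCT (mem_filter.1 hc').1) hne j h
      rw [← hinj, ← card_union_of_disjoint]
      · apply card_le_card
        intro x hx
        rcases mem_union.1 hx with h | h
        · obtain ⟨ha, hb⟩ := mem_filter.1 h
          exact mem_filter.2 ⟨mem_filter.2 ⟨(mem_sdiff.1 ha).1, hb⟩, Or.inl ha⟩
        · obtain ⟨c, hc, rfl⟩ := mem_image.1 h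
          obtain ⟨ha, hb⟩ := mem_filter.1 hc
          refine mem_filter.2 ⟨mem_filter.2 ⟨husX j (mem_used.2 ⟨c, hCT ha, rfl⟩), hb⟩, Or.inr (mem_used.2 ⟨c, ha, rfl⟩)⟩
      · rw [Finset.disjoint_left]
        intro x hx hx'
        obtain ⟨c, hc, rfl⟩ := mem_image.1 hx'
        obtain ⟨ha, hb⟩ := mem_filter.1 hc
        exact (mem_sdiff.1 (mem_filter.1 hx).1).2 (mem_used.2 ⟨c, hCT ha, rfl⟩)
    have h3 := hC j
    have h4 : M * ((X j).filter fun v => Good j v).card ≤ n * ((Z j).card + 2 ^ k) := by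
      calc _ ≤ M * (((W j).filter fun v => Good j v).card + (T.filter fun c => Good j (c j)).card) :=
            Nat.mul_le_mul_left _ h1
        _ ≤ n * ((W j).filter fun v => Good j v).card + n * ((C.filter fun c => Good j (c j)).card + 2 ^ k) := by
            rw [mul_add]
            exact Nat.add_le_add (Nat.mul_le_mul_right _ hMn) (by convert h3)
        _ = n * (((W j).filter fun v => Good j v).card + (C.filter fun c => Good j (c j)).card + 2 ^ k) := by ring
        _ ≤ _ := Nat.mul_le_mul_left _ (Nat.add_le_add_right h2 _)
    have h5 : (M : ℝ) * ((X j).filter fun v => Good j v).card ≤ n * ((Z j).card + 2 ^ k) := by exact_mod_cast h4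
    have h6 : (M : ℝ) * (δ1 * n) ≤ M * ((X j).filter fun v => Good j v).card :=
      mul_le_mul_of_nonneg_left (hGc j) (by positivity)
    have h7 : n * (δ1 * M) ≤ n * ((Z j).card + 2 ^ k : ℝ) := by linarith
    have h8 := le_of_mul_le_mul_left h7 hn'
    have : (s : ℝ) ≤ (Z j).card := by linarith
    exact_mod_cast this
  have hYex : ∀ j, ∃ Y ⊆ Z j, Y.card = s := fun j => Finset.exists_subset_card_eq (hsZ j)
  choose Y hYZ hYs using hYex
  have hYG : ∀ j, ∀ y ∈ Y j, Good j y := fun j y hy => (mem_filter.1 (mem_filter.1 (hYZ j hy)).1).2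
  obtain ⟨T', u, hT', hTc', hTW', -, -⟩ := rebuild P H hn K hK W Y s m η (ζ * β ^ 2 / 8) hη0
    (by rw [hη]; nlinarith) (by positivity) (by nlinarith [mul_pos hζ hβ]) hYs
    (by
      intro e he
      have v1 : ((2 * e : ℕ) : ZMod k).val = 2 * e := by
        rw [ZMod.val_natCast, Nat.mod_eq_of_lt (by omega)]
      have v2 : ((2 * e + 1 : ℕ) : ZMod k).val = 2 * e + 1 := by
        rw [ZMod.val_natCast, Nat.mod_eq_of_lt (by omega)]
      constructor
      · intro y hy
        have hg := hYG _ y hy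
        simp only [hGood] at hg
        rw [v1, if_pos (by simp)] at hg
        have e1 : ((2 * e + 1 : ℕ) : ZMod k) = ((2 * e : ℕ) : ZMod k) + 1 := by push_cast; ring
        rw [e1]; exact hg
      · intro y hy
        have hg := hYG _ y hy
        simp only [hGood] at hg
        rw [v2, if_neg (by simp)] at hg
        have e1 : ((2 * e + 1 : ℕ) : ZMod k) - 1 = ((2 * e : ℕ) : ZMod k) := by push_cast; ring
        rw [e1] at hg; exact hg)
    (fun j => le_trans (mul_le_mul_of_nonneg_right (by rw [hη]; nlinarith) hn'.le) (hWc j)) hsm hms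
    (by rw [hη]; linarith [show ζ * β * (ζ * β ^ 2 / 8) = ζ ^ 2 * β ^ 3 / 8 by ring]) (K * m) le_rfl
  have hin : ∀ c ∈ T', ∀ j, c j ∈ X j ∧ ∀ c' ∈ T \ C, c' j ≠ c j := by
    intro c hc j
    have h0 : c j ∈ X j ∧ (c j ∈ W j ∨ c j ∈ used C j) := by
      rcases mem_union.1 (hTW' c hc j) with h | h
      · exact ⟨(mem_sdiff.1 h).1, Or.inl h⟩
      · have := mem_filter.1 (hYZ j h)
        exact ⟨(mem_filter.1 this.1).1, this.2⟩
    refine ⟨h0.1, ?_⟩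
    intro c' hc' heq
    obtain ⟨ha, hb⟩ := mem_sdiff.1 hc'
    rcases h0.2 with h | h
    · exact (mem_sdiff.1 h).2 (mem_used.2 ⟨c', ha, heq⟩)
    · obtain ⟨c'', hc'', he⟩ := mem_used.1 h
      refine hT.2 c' ha c'' (hCT hc'') ?_ j (heq.trans he.symm)
      rintro rfl
      exact hb hc''
  have hmax := hTmax ((T \ C) ∪ T') ⟨⟨?_, ?_⟩, ?_⟩
  · have hdis : Disjoint (T \ C) T' := by
      rw [Finset.disjoint_left]
      intro c hc hc'
      exact (hin c hc' 0).2 c hc rfl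
    rw [card_union_of_disjoint hdis, card_sdiff_of_subset hCT, hTc'] at hmax
    have := card_le_card hCT
    omega
  · intro c hc
    rcases mem_union.1 hc with h | h
    · exact hT.1 c (mem_sdiff.1 h).1
    · exact hT'.1 c h
  · intro c hc c' hc' hne j
    rcases mem_union.1 hc with h | h <;> rcases mem_union.1 hc' with h' | h'
    · exact hT.2 c (mem_sdiff.1 h).1 c' (mem_sdiff.1 h').1 hne j
    · exact (hin c' h' j).2 c h
    · exact ((hin c h j).2 c' h').symm
    · exact hT'.2 c h c' h' hne j
  · intro c hc j
    rcases mem_union.1 hc with h | h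
    · exact hTF c (mem_sdiff.1 h).1 j
    · have := (hin c h j).1
      simpa [hX] using this

end TCF

namespace TCF
open Finset
open scoped Classical

variable {k n : ℕ} {E : ZMod k → Fin n → Fin n → Prop} {δ α β : ℝ}

theorem hall_match {q : ℕ} (R : Finset (Fin n)) (hR : R.card = q) (p : Fin q → Fin n → Prop)
    (h1 : ∀ x ∈ R, q < 2 * (univ.filter fun t => p t x).card)
    (h2 : ∀ t, q ≤ 2 * (R.filter fun x => p t x).card) :
    ∃ f : Fin q → Fin n, Function.Injective f ∧ ∀ t, f t ∈ R ∧ p t (f t) := by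
  have := (Finset.all_card_le_biUnion_card_iff_exists_injective
    (fun t : Fin q => R.filter fun x => p t x)).1 ?_
  · obtain ⟨f, hf, hf'⟩ := this
    exact ⟨f, hf, fun t => mem_filter.1 (hf' t)⟩
  · intro s
    rcases s.eq_empty_or_nonempty with rfl | ⟨t, ht⟩
    · simp
    by_cases hs : 2 * s.card ≤ q
    · have hsub : (R.filter fun x => p t x) ⊆ s.biUnion (fun t : Fin q => R.filter fun x => p t x) :=
        subset_biUnion_of_mem (fun t : Fin q => R.filter fun x => p t x) ht
      have := card_le_card hsub
      have := h2 t
      omega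
    · have hsub : R ⊆ s.biUnion (fun t : Fin q => R.filter fun x => p t x) := by
        intro x hx
        have hx1 := h1 x hx
        by_contra hcon
        have hd : Disjoint s (univ.filter fun t => p t x) := by
          rw [Finset.disjoint_left]
          intro t ht ht'
          exact hcon (mem_biUnion.2 ⟨t, ht, mem_filter.2 ⟨hx, (mem_filter.1 ht').2⟩⟩)
        have h3 := card_union_of_disjoint hd
        have h4 := card_le_univ (s ∪ univ.filter fun t => p t x)
        rw [Fintype.card_fin] at h4
        omega
      have h3 := card_le_card hsub
      have h4 := card_le_univ s
      rw [Fintype.card_fin] at h4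
      omega

theorem slice_biUnion_card {ι : Type*} (s : Finset ι) (A : ι → Finset (ZMod k × Fin n))
    (hd : ∀ x y, x ≠ y → Disjoint (A x) (A y)) (j : ZMod k) :
    (slice (s.biUnion A) j).card = ∑ z ∈ s, (slice (A z) j).card := by
  have : slice (s.biUnion A) j = s.biUnion fun z => slice (A z) j := by
    ext x; simp
  rw [this, card_biUnion]
  intro x _ y _ hxy
  have := hd x y hxy
  change Disjoint (slice (A x) j) (slice (A y) j)
  rw [Finset.disjoint_left] at this ⊢
  intro a ha hb
  exact this (mem_slice.1 ha) (mem_slice.1 hb)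

theorem card_slice_disj {A B : Finset (ZMod k × Fin n)} (hd : Disjoint A B) (j : ZMod k) :
    (slice (A ∪ B) j).card = (slice A j).card + (slice B j).card := by
  rw [slice_union, card_union_of_disjoint]
  rw [Finset.disjoint_left] at hd ⊢
  intro a ha hb
  exact hd (mem_slice.1 ha) (mem_slice.1 hb)

theorem exc_count [NeZero k] {q : ℕ} (hq : 0 < q) (N : ZMod k → Fin n → Prop) (Q : ZMod k × Fin q → Finset (Fin n))
    (e : ℝ) (h : ∀ z : ZMod k × Fin q, ((univ.filter fun x => N z.1 x ∧ x ∉ Q z).card : ℝ) ≤ e) :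
    ((univ.filter fun y : ZMod k × Fin n => N y.1 y.2 ∧
      q ≤ 2 * (univ.filter fun t => y.2 ∉ Q (y.1, t)).card).card : ℝ) ≤ 2 * k * e := by
  set X := univ.filter fun y : ZMod k × Fin n => N y.1 y.2 ∧
      q ≤ 2 * (univ.filter fun t => y.2 ∉ Q (y.1, t)).card with hX
  have h1 : X.card * q ≤ ∑ y ∈ X, 2 * (univ.filter fun t => y.2 ∉ Q (y.1, t)).card := by
    rw [← smul_eq_mul]
    exact card_nsmul_le_sum _ _ _ (fun y hy => (mem_filter.1 hy).2.2)
  have h2 : ∑ y ∈ X, (univ.filter fun t => y.2 ∉ Q (y.1, t)).card ≤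
      ∑ y : ZMod k × Fin n, ∑ t : Fin q, if N y.1 y.2 ∧ y.2 ∉ Q (y.1, t) then 1 else 0 := by
    calc _ = ∑ y ∈ X, ∑ t : Fin q, if N y.1 y.2 ∧ y.2 ∉ Q (y.1, t) then 1 else 0 := by
          apply sum_congr rfl
          intro y hy
          have hN := (mem_filter.1 hy).2.1
          rw [card_filter]
          apply sum_congr rfl
          intro t _
          simp [hN]
      _ ≤ _ := sum_le_sum_of_subset (subset_univ X)
  have h3 : (∑ y : ZMod k × Fin n, ∑ t : Fin q, if N y.1 y.2 ∧ y.2 ∉ Q (y.1, t) then 1 else 0) =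
      ∑ z : ZMod k × Fin q, (univ.filter fun x => N z.1 x ∧ x ∉ Q z).card := by
    rw [Fintype.sum_prod_type, Fintype.sum_prod_type]
    apply sum_congr rfl
    intro i _
    rw [sum_comm]
    apply sum_congr rfl
    intro t _
    rw [card_filter]
  have h4 : (∑ z : ZMod k × Fin q, ((univ.filter fun x => N z.1 x ∧ x ∉ Q z).card : ℝ)) ≤ k * q * e := by
    have := sum_le_sum (s := (univ : Finset (ZMod k × Fin q))) (fun z _ => h z)
    rw [sum_const, card_univ, Fintype.card_prod, ZMod.card, Fintype.card_fin, nsmul_eq_mul] at this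
    push_cast at this
    exact this
  rw [← mul_sum] at h1
  rw [h3] at h2
  have h5 : X.card * q ≤ 2 * ∑ z : ZMod k × Fin q, (univ.filter fun x => N z.1 x ∧ x ∉ Q z).card := by omega
  have h6 : (X.card * q : ℝ) ≤ 2 * ∑ z : ZMod k × Fin q, ((univ.filter fun x => N z.1 x ∧ x ∉ Q z).card : ℝ) := by
    exact_mod_cast h5
  have hq' : (0:ℝ) < q := by exact_mod_cast hq
  have h7 : (X.card : ℝ) * q ≤ (2 * k * e) * q := by linarith
  exact le_of_mul_le_mul_right h7 hq'

set_option maxHeartbeats 1000000 in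
theorem tile_univ [NeZero k] (P : Par k δ α β) (H : Hyp E δ α) (hn : 3 ≤ β * n)
    (ε : ℝ) (hε : 0 < ε) (hε1 : ε + β ≤ 1) (B q : ℕ)
    (hF : (k * q : ℝ) * (4 * k * (B + 1)) + 2 * k * (ε * n) ≤ β * n)
    (hbig : 4 * k * (B + 1) < δ ^ 2 / 4 * (ε * n))
    (hpow : (1 - δ ^ 2 / 4) ^ (B + 1) ≤ ε) (hqε : 2 * (ε * n) ≤ q)
    (ζ : ℝ) (hζ : 0 < ζ) (hζ1 : ζ ≤ 1) (hζq : ζ * n ≤ q)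
    (hα32 : 32 * α ≤ ζ ^ 2 * β ^ 3) (hN : (2:ℝ) ^ (k + 1) + 15 ≤ ζ * β ^ 2 * n) :
    Tile E (univ : Finset (ZMod k × Fin n)) := by
  have hk := P.hk
  have hα := P.hα
  have hαβ := P.hαβ
  have hβδ := P.hβδ
  have hδ := P.hδ
  have hkp := P.two_pos
  have hβ : 0 < β := by linarith
  have hβ8 : β ≤ 1 / 8 := by linarith
  have hn' : (0:ℝ) < n := by
    by_contra h
    have : β * (n:ℝ) ≤ 0 := mul_nonpos_of_nonneg_of_nonpos hβ.le (not_lt.1 h)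
    linarith
  have hn0 : 0 < n := by exact_mod_cast hn'
  have hεn : 0 < ε * n := by positivity
  have hq' : (0:ℝ) < q := by linarith
  have hq0 : 0 < q := by exact_mod_cast hq'
  have hk1 : (1:ℝ) ≤ k := by exact_mod_cast (by omega : 1 ≤ k)
  have hke : 0 ≤ 2 * k * (ε * n) := by positivity
  obtain ⟨A, Q, hAc, hAd, hAcc, hAt, hAQ⟩ := gadgets P H hn ε hε hε1 B q (by linarith) hbig hpow
  choose t ht using hAt
  set 𝒢 := (univ : Finset (ZMod k × Fin q)).biUnion A with h𝒢
  have h𝒢mem : ∀ y, y ∈ 𝒢 ↔ ∃ z, y ∈ A z := by intro y; simp [h𝒢]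
  have h𝒢not : ∀ y, (∀ w, y ∉ A w) ↔ y ∉ 𝒢 := by intro y; rw [h𝒢mem]; push Not; rfl
  have h𝒢s : ∀ j, (slice 𝒢 j).card + q = ∑ z, t z := by
    intro j
    rw [h𝒢, slice_biUnion_card _ _ hAd]
    have : q = ∑ z : ZMod k × Fin q, if j = z.1 then 1 else 0 := by
      rw [Fintype.sum_prod_type_right]
      simp
    calc ∑ z, (slice (A z) j).card + q
        = ∑ z, (slice (A z) j).card + ∑ z : ZMod k × Fin q, (if j = z.1 then 1 else 0) := by rw [← this]
      _ = _ := by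
        rw [← sum_add_distrib]
        exact sum_congr rfl (fun z _ => ht z j)
  have h𝒢b : ∀ j, ((slice 𝒢 j).card : ℝ) ≤ (k * q : ℝ) * (4 * k * (B + 1)) := by
    intro j
    have h1 : (slice 𝒢 j).card ≤ ∑ z : ZMod k × Fin q, 4 * k * (B + 1) := by
      rw [h𝒢, slice_biUnion_card _ _ hAd]
      exact sum_le_sum (fun z _ => (card_slice_le _ _).trans (hAc z))
    rw [sum_const, card_univ, Fintype.card_prod, ZMod.card, Fintype.card_fin, smul_eq_mul] at h1
    exact_mod_cast h1
  set X := univ.filter fun y : ZMod k × Fin n => (∀ w, (y.1, y.2) ∉ A w) ∧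
      q ≤ 2 * (univ.filter fun t => y.2 ∉ Q (y.1, t)).card with hX
  have hXc : (X.card : ℝ) ≤ 2 * k * (ε * n) := by
    have := exc_count hq0 (fun i x => ∀ w, (i, x) ∉ A w) Q (ε * n) (by intro z; convert hAQ z)
    convert this
  have hX𝒢 : Disjoint X 𝒢 := by
    rw [Finset.disjoint_left]
    intro y hy
    exact (h𝒢not y).1 (mem_filter.1 hy).2.1
  obtain ⟨C, hC, hC𝒢, hXC, hCc⟩ := cover P H 𝒢 X.card (by
    intro j
    have := h𝒢b j
    linarith) X hX𝒢 le_rfl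
  obtain ⟨cc, hcc⟩ := hC.card
  have hd𝒢C : Disjoint 𝒢 C := hC𝒢.symm
  have hs𝒢C : ∀ j, (slice (𝒢 ∪ C) j).card + q = (∑ z, t z) + cc := by
    intro j
    rw [card_slice_disj hd𝒢C, hcc, ← h𝒢s j]; omega
  set f := (slice (𝒢 ∪ C) 0).card with hf
  have hff : ∀ j, (slice (𝒢 ∪ C) j).card = f := by
    intro j
    have h1 := hs𝒢C j
    have h2 := hs𝒢C 0
    omega
  have hfβ : (f : ℝ) ≤ β * n := by
    have h1 : (f:ℝ) ≤ (slice 𝒢 0).card + (slice C 0).card := by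
      exact_mod_cast card_slice_union_le 𝒢 C 0
    have h2 := h𝒢b 0
    have h3 : ((slice C 0).card : ℝ) ≤ X.card := by exact_mod_cast hCc 0
    linarith
  obtain ⟨T0, hT0, hT0F, hT0n⟩ := almost P H hn0 (𝒢 ∪ C) f hff hfβ ζ hζ hζ1 hα32 hN
  have hT0n' : n ≤ f + T0.card + q := by
    have : (n:ℝ) ≤ f + T0.card + q := by linarith
    exact_mod_cast this
  have hqβ : (q:ℝ) ≤ β * n := by
    have h1 : (1:ℝ) ≤ k * (4 * k * (B + 1)) := by
      have : (1:ℝ) ≤ 4 * k * (B + 1) := by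
        have : (0:ℝ) ≤ B := by positivity
        nlinarith
      nlinarith
    have h2 : (q:ℝ) * 1 ≤ q * (k * (4 * k * (B + 1))) := mul_le_mul_of_nonneg_left h1 hq'.le
    nlinarith
  have hfq : f + q ≤ n := by
    have : (f + q : ℝ) ≤ n := by nlinarith
    exact_mod_cast this
  obtain ⟨T, hTT0, hTc⟩ := Finset.exists_subset_card_eq (s := T0) (n := n - f - q) (by omega)
  have hT : Til E T := ⟨fun c hc => hT0.1 c (hTT0 hc), fun c hc c' hc' => hT0.2 c (hTT0 hc) c' (hTT0 hc')⟩
  set D := univ.filter fun y : ZMod k × Fin n => ∃ c ∈ T, c y.1 = y.2 with hD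
  have hDt : Tile E D := ⟨T, hT, by intro i a; simp [hD]⟩
  have hDs : ∀ j, (slice D j).card = n - f - q := by
    intro j
    rw [← hTc, ← hT.card_image j]
    congr 1
    ext a
    simp [hD]
  have hDd : Disjoint (𝒢 ∪ C) D := by
    rw [Finset.disjoint_right]
    intro y hy
    obtain ⟨c, hc, he⟩ := (mem_filter.1 hy).2
    have := hT0F c (hTT0 hc) y.1
    rwa [he] at this
  set R : ZMod k → Finset (Fin n) := fun i => (slice (𝒢 ∪ C ∪ D) i)ᶜ with hR
  have hRc : ∀ i, (R i).card = q := by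
    intro i
    simp only [hR]
    rw [card_compl, Fintype.card_fin, card_slice_disj hDd, hff, hDs]
    omega
  have hRm : ∀ i x, x ∈ R i → (i, x) ∉ 𝒢 ∧ (i, x) ∉ C ∧ (i, x) ∉ D := by
    intro i x hx
    simpa [hR, not_or, and_assoc] using hx
  have hmatch : ∀ i, ∃ g : Fin q → Fin n, Function.Injective g ∧ ∀ s, g s ∈ R i ∧ g s ∈ Q (i, s) := by
    intro i
    apply hall_match (R i) (hRc i) (fun s x => x ∈ Q (i, s))
    · intro x hx
      obtain ⟨h1, h2, h3⟩ := hRm i x hx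
      have h4 : ¬ (q ≤ 2 * (univ.filter fun s => x ∉ Q (i, s)).card) := by
        intro h
        exact h2 (hXC (mem_filter.2 ⟨mem_univ _, (h𝒢not _).2 h1, h⟩))
      have h5 := card_filter_add_card_filter_not (s := (univ : Finset (Fin q))) (fun s => x ∈ Q (i, s))
      rw [card_univ, Fintype.card_fin] at h5
      have h6 : q < 2 * (univ.filter fun s => x ∈ Q (i, s)).card := by omega
      convert h6
    · intro s
      have h1 := hAQ (i, s)
      have h2 : (R i).filter (fun x => x ∉ Q (i, s)) ⊆
          univ.filter fun x => (∀ w, (i, x) ∉ A w) ∧ x ∉ Q (i, s) := by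
        intro x hx
        obtain ⟨ha, hb⟩ := mem_filter.1 hx
        exact mem_filter.2 ⟨mem_univ _, (h𝒢not _).2 (hRm i x ha).1, hb⟩
      have h3 : (((R i).filter fun x => x ∉ Q (i, s)).card : ℝ) ≤ ε * n :=
        le_trans (Nat.cast_le.2 (by convert card_le_card h2)) h1
      have h4 : 2 * ((R i).filter fun x => x ∉ Q (i, s)).card ≤ q := by
        have : (2 * ((R i).filter fun x => x ∉ Q (i, s)).card : ℝ) ≤ q := by linarith
        exact_mod_cast this
      have h5 := card_filter_add_card_filter_not (s := R i) (fun x => x ∈ Q (i, s))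
      rw [hRc] at h5
      have h6 : q ≤ 2 * ((R i).filter fun x => x ∈ Q (i, s)).card := by omega
      convert h6
  choose g hginj hg using hmatch
  have hgsurj : ∀ i, ∀ x ∈ R i, ∃ s, g i s = x := by
    intro i x hx
    have h1 : univ.image (g i) = R i := by
      apply eq_of_subset_of_card_le
      · intro y hy
        obtain ⟨s, _, rfl⟩ := mem_image.1 hy
        exact (hg i s).1
      · rw [card_image_of_injective _ (hginj i), hRc, card_univ, Fintype.card_fin]
    rw [← h1] at hx
    obtain ⟨s, _, h⟩ := mem_image.1 hx
    exact ⟨s, h⟩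
  set V : ZMod k × Fin q → Finset (ZMod k × Fin n) := fun z => insert (z.1, g z.1 z.2) (A z) with hV
  have hgA : ∀ z w : ZMod k × Fin q, (z.1, g z.1 z.2) ∉ A w := by
    intro z w
    exact (h𝒢not _).2 (hRm _ _ (hg z.1 z.2).1).1 w
  have hVt : ∀ z, Tile E (V z) := fun z => hAcc z _ (hg z.1 z.2).2 (hgA z z)
  have hVd : ∀ z w, z ≠ w → Disjoint (V z) (V w) := by
    intro z w hzw
    simp only [hV]
    rw [disjoint_insert_left, disjoint_insert_right]
    refine ⟨?_, hgA w z, hAd z w hzw⟩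
    rw [mem_insert, not_or]
    refine ⟨?_, hgA z w⟩
    intro h
    obtain ⟨z1, z2⟩ := z
    obtain ⟨w1, w2⟩ := w
    simp only [Prod.mk.injEq] at h
    obtain ⟨rfl, h⟩ := h
    exact hzw (by rw [hginj _ h])
  have hVall := Tile.biUnion univ V (fun z _ => hVt z) (fun z _ w _ h => hVd z w h)
  have hCD : Disjoint C D := hDd.mono_left subset_union_right
  have hfin := (hC.union hDt hCD).union hVall (by
    rw [Finset.disjoint_right]
    intro y hy hy'
    obtain ⟨z, _, hz⟩ := mem_biUnion.1 hy
    rcases mem_insert.1 hz with h | h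
    · have := hRm _ _ (hg z.1 z.2).1
      rw [← h] at this
      rcases mem_union.1 hy' with h' | h'
      · exact this.2.1 h'
      · exact this.2.2 h'
    · have hyG : y ∈ 𝒢 := (h𝒢mem y).2 ⟨z, h⟩
      rcases mem_union.1 hy' with h' | h'
      · exact Finset.disjoint_left.1 hd𝒢C hyG h'
      · exact Finset.disjoint_left.1 hDd (mem_union_left _ hyG) h')
  convert hfin
  symm
  rw [eq_univ_iff_forall]
  rintro ⟨i, x⟩
  by_cases hx : x ∈ R i
  · obtain ⟨s, rfl⟩ := hgsurj i x hx
    exact mem_union_right _ (mem_biUnion.2 ⟨(i, s), mem_univ _, mem_insert_self _ _⟩)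
  · have hx' : (i, x) ∈ 𝒢 ∪ C ∪ D := by
      by_contra hc
      apply hx
      simp only [hR, mem_compl, mem_slice]
      exact hc
    rcases mem_union.1 hx' with h | h
    · rcases mem_union.1 h with h | h
      · obtain ⟨z, hz⟩ := (h𝒢mem _).1 h
        exact mem_union_right _ (mem_biUnion.2 ⟨z, mem_univ _, mem_insert_of_mem hz⟩)
      · exact mem_union_left _ (mem_union_left _ h)
    · exact mem_union_left _ (mem_union_right _ h)

theorem factor_of_tile [NeZero k] (h : Tile E (univ : Finset (ZMod k × Fin n))) :
    ∃ c : Fin n → ZMod k → Fin n, (∀ j i, E i (c j i) (c j (i + 1))) ∧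
      ∀ i, Function.Bijective (fun j => c j i) := by
  obtain ⟨T, hT, hS⟩ := h
  have hTn : T.card = n := by
    rw [← hT.card_image 0]
    have : (T.image fun c => c 0) = univ := by
      rw [eq_univ_iff_forall]
      intro a
      obtain ⟨c, hc, h⟩ := (hS 0 a).1 (mem_univ _)
      exact mem_image.2 ⟨c, hc, h⟩
    rw [this, card_univ, Fintype.card_fin]
  let e : Fin n ≃ T := (T.equivFinOfCardEq hTn).symm
  refine ⟨fun j => (e j).1, fun j i => hT.1 _ (e j).2 i, fun i => ?_⟩
  have hinj : Function.Injective (fun j => (e j).1 i) := by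
    intro a b hab
    by_contra hne
    exact hT.2 _ (e a).2 _ (e b).2 (fun h => hne (e.injective (Subtype.ext h))) i hab
  exact ⟨hinj, Finite.surjective_of_injective hinj⟩

end TCF

namespace TCF
open Finset
open scoped Classical

theorem exists_large (c d : ℝ) (hc : 0 < c) : ∃ n₀ : ℕ, ∀ n : ℕ, n₀ ≤ n → d ≤ c * n := by
  obtain ⟨N, hN⟩ := exists_nat_ge (d / c)
  refine ⟨N, fun n hn => ?_⟩
  have h1 : (N:ℝ) ≤ n := by exact_mod_cast hn
  have h2 : d / c ≤ n := hN.trans h1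
  rw [div_le_iff₀ hc] at h2
  linarith

theorem main (k : ℕ) (hk : 4 ≤ k) (hk4 : 4 ∣ k) (δ : ℝ) (hδ : 2 / k < δ) (hδ1 : δ ≤ 1) :
    ∃ α : ℝ, 0 < α ∧ ∃ n₀ : ℕ, ∀ n : ℕ, n₀ ≤ n → ∀ E : ZMod k → Fin n → Fin n → Prop, Hyp E δ α →
      ∃ c : Fin n → ZMod k → Fin n, (∀ j i, E i (c j i) (c j (i + 1))) ∧
      ∀ i, Function.Bijective (fun j => c j i) := by
  have : NeZero k := ⟨by omega⟩
  have hk1 : (1:ℝ) ≤ k := by exact_mod_cast (by omega : 1 ≤ k)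
  have hkp : 0 < 2 / (k:ℝ) := by positivity
  obtain ⟨β, hβd⟩ : ∃ β, β = (δ - 2 / k) / 8 := ⟨_, rfl⟩
  have hβ : 0 < β := by rw [hβd]; linarith
  have hβ8 : β ≤ 1 / 8 := by rw [hβd]; linarith
  have hδ0 : 0 < δ := by linarith
  have hγ : 0 < δ ^ 2 / 4 := by positivity
  have hγ1 : δ ^ 2 / 4 < 1 := by nlinarith
  have hlim := tendsto_self_mul_const_pow_of_lt_one (r := 1 - δ ^ 2 / 4) (by linarith) (by linarith)
  have hb : 0 < β / (14 * k ^ 2) := by positivity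
  have hev := (hlim.eventually_lt_const hb).and (Filter.eventually_ge_atTop 1)
  obtain ⟨m, hm, hm1⟩ := hev.exists
  obtain ⟨B, rfl⟩ : ∃ B, m = B + 1 := ⟨m - 1, by omega⟩
  obtain ⟨ε, hεd⟩ : ∃ ε, ε = (1 - δ ^ 2 / 4) ^ (B + 1) := ⟨_, rfl⟩
  rw [← hεd] at hm
  have hε : 0 < ε := by rw [hεd]; exact pow_pos (by linarith) _
  rw [lt_div_iff₀ (by positivity)] at hm
  push_cast at hm
  have hB : (0:ℝ) ≤ B := by positivity
  have hk2 : (1:ℝ) ≤ k ^ 2 := by nlinarith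
  have hεk : ε * k ^ 2 * 14 ≤ β := by nlinarith [mul_nonneg hB (mul_nonneg hε.le (sq_nonneg (k:ℝ)))]
  have hε14 : ε * 14 ≤ β := by nlinarith
  have hα : 0 < min β ((2 * ε) ^ 2 * β ^ 3 / 32) := lt_min hβ (by positivity)
  refine ⟨min β ((2 * ε) ^ 2 * β ^ 3 / 32), hα, ?_⟩
  obtain ⟨n1, h1⟩ := exists_large β 3 hβ
  obtain ⟨n2, h2⟩ := exists_large (δ ^ 2 / 4 * ε) (4 * k * (B + 1) + 1) (by positivity)
  obtain ⟨n3, h3⟩ := exists_large (2 * ε * β ^ 2) ((2:ℝ) ^ (k + 1) + 15) (by positivity)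
  obtain ⟨n4, h4⟩ := exists_large ε 1 hε
  refine ⟨max (max n1 n2) (max n3 n4), fun n hn E H => ?_⟩
  simp only [max_le_iff] at hn
  have h1 := h1 n hn.1.1
  have h2 := h2 n hn.1.2
  have h3 := h3 n hn.2.1
  have h4 := h4 n hn.2.2
  apply factor_of_tile
  have P : Par k δ (min β ((2 * ε) ^ 2 * β ^ 3 / 32)) β :=
    ⟨hk, hk4, hα, min_le_left _ _, by rw [hβd]; linarith, hδ1⟩
  have hq1 : 2 * (ε * n) ≤ (⌈2 * (ε * n)⌉₊ : ℝ) := Nat.le_ceil _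
  have hq2 : (⌈2 * (ε * n)⌉₊ : ℝ) < 2 * (ε * n) + 1 := Nat.ceil_lt_add_one (by positivity)
  refine tile_univ P H h1 ε hε (by linarith) B ⌈2 * (ε * n)⌉₊ ?_ (by linarith) hεd.symm.le hq1 (2 * ε)
    (by positivity) (by linarith) (by linarith) ?_ h3
  · have hq3 : (⌈2 * (ε * n)⌉₊ : ℝ) ≤ 3 * (ε * n) := by linarith
    have e1 : (k * (⌈2 * (ε * n)⌉₊ : ℝ)) * (4 * k * (B + 1)) ≤ (k * (3 * (ε * n))) * (4 * k * (B + 1)) := by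
      gcongr
    have e2 : (k * (3 * (ε * n))) * (4 * k * (B + 1)) = 12 * ((B + 1) * ε * k ^ 2) * n := by ring
    have e3 : 2 * k * (ε * n) ≤ 2 * ((B + 1) * ε * k ^ 2) * n := by
      have : (k:ℝ) * ε ≤ (B + 1) * ε * k ^ 2 := by
        have : (k:ℝ) * 1 ≤ k * ((B + 1) * k) := mul_le_mul_of_nonneg_left (by nlinarith) (by linarith)
        nlinarith
      have := mul_le_mul_of_nonneg_right this (Nat.cast_nonneg (α := ℝ) n)
      linarith
    have e4 : ((B + 1) * ε * (14 * k ^ 2)) * n ≤ β * n :=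
      mul_le_mul_of_nonneg_right hm.le (Nat.cast_nonneg n)
    linarith
  · have := min_le_right β ((2 * ε) ^ 2 * β ^ 3 / 32)
    linarith

end TCF

theorem transversal_cycle_factor
    (k : ℕ) (hk : 0 < k) (hk4 : 4 ∣ k) (δ : ℝ) (hδ : 2 / k < δ) :
    ∃ α : ℝ, 0 < α ∧ ∃ n₀ : ℕ, ∀ n : ℕ, n₀ ≤ n →
      ∀ G : SimpleGraph (ZMod k × Fin n),
        (∀ u v : ZMod k × Fin n, G.Adj u v → v.1 = u.1 + 1 ∨ u.1 = v.1 + 1) →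
        (∀ (i : ZMod k) (a : Fin n),
          δ * n ≤ (({b : Fin n | G.Adj (i, a) (i + 1, b)}).ncard : ℝ) ∧
          δ * n ≤ (({b : Fin n | G.Adj (i, a) (i - 1, b)}).ncard : ℝ)) →
        (∀ (i : ZMod k) (S T : Finset (Fin n)), S.card = T.card →
          α * n ≤ (S.card : ℝ) → ∃ a ∈ S, ∃ b ∈ T, G.Adj (i, a) (i + 1, b)) →
        ∃ c : Fin n → ZMod k → Fin n,
          (∀ (j : Fin n) (i : ZMod k), G.Adj (i, c j i) (i + 1, c j (i + 1))) ∧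
          ∀ i : ZMod k, Function.Bijective (fun j => c j i) := by
  classical
  have hk' : 4 ≤ k := Nat.le_of_dvd hk hk4
  have hkr : (4:ℝ) ≤ k := by exact_mod_cast hk'
  have h1 : 2 / (k:ℝ) < 1 := by
    rw [div_lt_one (by linarith)]; linarith
  obtain ⟨α, hα, n₀, h⟩ := TCF.main k hk' hk4 (min δ 1) (lt_min hδ h1) (min_le_right _ _)
  refine ⟨α, hα, n₀, fun n hn G _ hdeg hhole => ?_⟩
  have hle : min δ 1 * (n:ℝ) ≤ δ * n := mul_le_mul_of_nonneg_right (min_le_left _ _) (Nat.cast_nonneg n)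
  refine h n hn (fun i a b => G.Adj (i, a) (i + 1, b)) ⟨?_, ?_, ?_⟩
  · intro i a
    have h2 := (hdeg i a).1
    rw [Set.ncard_eq_toFinset_card', Set.toFinset_ofPred] at h2
    refine hle.trans ?_
    convert h2
  · intro i b
    have h2 := (hdeg (i + 1) b).2
    rw [Set.ncard_eq_toFinset_card', Set.toFinset_ofPred, add_sub_cancel_right] at h2
    refine hle.trans ?_
    refine h2.trans (Nat.cast_le.2 (Finset.card_le_card ?_))
    intro x hx
    have hx' := (Finset.mem_filter.1 hx).2
    exact Finset.mem_filter.2 ⟨Finset.mem_univ _, G.adj_symm hx'⟩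
  · intro i S T hS hT
    rcases le_total S.card T.card with hST | hST
    · obtain ⟨T', hT', hc⟩ := Finset.exists_subset_card_eq hST
      obtain ⟨a, ha, b, hb, hab⟩ := hhole i S T' hc.symm hS
      exact ⟨a, ha, b, hT' hb, hab⟩
    · obtain ⟨S', hS', hc⟩ := Finset.exists_subset_card_eq hST
      obtain ⟨a, ha, b, hb, hab⟩ := hhole i S' T hc (by rw [hc]; exact hT)
      exact ⟨a, hS' ha, b, hb, hab⟩
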